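/- arXiv:2104.12185 — 2 statements merged into one kernel-verified Lean document; each statement's English description precedes it below -/
import Mathlib

section
/- Let q ≥ 5 be a prime power, F_q the finite field with q elements, k a positive divisor of q-1 with k ≥ 2, and f(x) = ax² + bx + c ∈ F_q[x] a quadratic polynomial (a ≠ 0) with b² - 4ac ≠ 0. Then for every positive divisor t of q-1, N(t, k) ≥ (φ(t)/(k t)) · (q - 2k W(t) q^{1/2}), where φ is Euler's totient function. -/
open scoped Classical

/-- `g` is a primitive element of the finite field `F`, i.e. a generator of `Fˣ`. -/
def IsPrimitiveElement {F : Type*} [Field F] [Fintype F] (g : F) : Prop :=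
  ∀ y : F, y ≠ 0 → ∃ n : ℕ, g ^ n = y

/-- `x` is `t`-free: `x ≠ 0` and `x = y ^ d` with `d ∣ t`, `d > 0` forces `d = 1`. -/
def IsTFree {F : Type*} [Field F] (t : ℕ) (x : F) : Prop :=
  x ≠ 0 ∧ ∀ d : ℕ, 0 < d → d ∣ t → (∃ y : F, y ^ d = x) → d = 1

/-- `N(t, k)`: the number of `t`-free `x ∈ F` with `f(x) = a x² + b x + c` a nonzero
`k`-th power. -/
noncomputable def Ncount (F : Type*) [Field F] [Fintype F] (a b c : F) (t k : ℕ) : ℕ :=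
  Nat.card {x : F | IsTFree t x ∧ ∃ y : F, y ≠ 0 ∧ y ^ k = a * x ^ 2 + b * x + c}

/-- `W(n)`: the number of squarefree positive divisors of `n`. -/
noncomputable def Wnum (n : ℕ) : ℕ := (n.divisors.filter Squarefree).card

/-- `Rad(n)`: the product of the distinct primes dividing `n`. -/
noncomputable def rad (n : ℕ) : ℕ := ∏ p ∈ n.primeFactors, p

section Helpers

open Polynomial

section Sparse

variable {K : Type*} [Field K]

lemma forall_eq_zero_of_sum_eq_zero_of_rootMultiplicity {ι : Type*} (s : Finset ι) (p : ι → K[X])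
    (α : K)
    (hinj : ∀ i ∈ s, ∀ j ∈ s, p i ≠ 0 → p j ≠ 0 →
      (p i).rootMultiplicity α = (p j).rootMultiplicity α → i = j)
    (hsum : ∑ i ∈ s, p i = 0) : ∀ i ∈ s, p i = 0 := by
  by_contra! hne
  obtain ⟨i₁, hi₁, hp₁⟩ := hne
  obtain ⟨i₀, hi₀, hmin⟩ := Finset.exists_min_image (s.filter fun i => p i ≠ 0)
    (fun i => (p i).rootMultiplicity α) ⟨i₁, by simp [hi₁, hp₁]⟩
  rw [Finset.mem_filter] at hi₀
  have hdvd : (X - C α) ^ ((p i₀).rootMultiplicity α + 1) ∣ p i₀ := by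
    rw [← Finset.add_sum_erase s p hi₀.1, add_eq_zero_iff_eq_neg] at hsum
    rw [hsum, dvd_neg]
    refine Finset.dvd_sum fun i hi => ?_
    rw [← hsum]
    rw [Finset.mem_erase] at hi
    by_cases hpi : p i = 0
    · simp [hpi]
    · rw [← le_rootMultiplicity_iff hpi]
      refine lt_of_le_of_ne (hmin i (by simp [hi.2, hpi])) fun h => ?_
      exact hi.1 (hinj i hi.2 i₀ hi₀.1 hpi hi₀.2 h.symm)
  rw [← le_rootMultiplicity_iff hi₀.2] at hdvd
  omega

/-- A polynomial all of whose exponents have remainder less than `d` modulo `P`. -/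
def IsSparse (P d : ℕ) (f : K[X]) : Prop := ∀ n, f.coeff n ≠ 0 → n % P < d

lemma IsSparse.sum {ι : Type*} {P d : ℕ} {s : Finset ι} {f : ι → K[X]}
    (h : ∀ i ∈ s, IsSparse P d (f i)) : IsSparse P d (∑ i ∈ s, f i) := by
  intro n hn
  rw [finsetSum_coeff] at hn
  obtain ⟨i, hi, hne⟩ := Finset.exists_ne_zero_of_sum_ne_zero hn
  exact h i hi n hne

lemma isSparse_mul_expand {P d : ℕ} (hP : 0 < P) (hd : d ≤ P) {f : K[X]} (hf : f.natDegree < d)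
    (g : K[X]) : IsSparse P d (f * expand K P g) := by
  intro n hn
  rw [coeff_mul] at hn
  obtain ⟨⟨i, j⟩, hij, hne⟩ := Finset.exists_ne_zero_of_sum_ne_zero hn
  replace hij : i + j = n := Finset.HasAntidiagonal.mem_antidiagonal.mp hij
  dsimp only at hne
  have hi : i < d := lt_of_le_of_lt (le_natDegree_of_ne_zero (left_ne_zero_of_mul hne)) hf
  have hj := right_ne_zero_of_mul hne
  rw [coeff_expand hP] at hj
  split_ifs at hj with hdvd
  · obtain ⟨k, rfl⟩ := hdvd
    rw [← hij, Nat.add_mul_mod_self_left, Nat.mod_eq_of_lt (hi.trans_le hd)]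
    exact hi
  · exact absurd rfl hj

lemma IsSparse.taylor {p r d : ℕ} [hp : Fact p.Prime] [CharP K p] (hd : d ≤ p ^ r)
    {f : K[X]} (hf : IsSparse (p ^ r) d f) (α : K) :
    IsSparse (p ^ r) d (f.taylor α) := by
  have hP : 0 < p ^ r := pow_pos hp.out.pos r
  rw [f.as_sum_support_C_mul_X_pow, map_sum]
  refine IsSparse.sum fun n hn => ?_
  have hX : ((X : K[X]) + C α) ^ n = (X + C α) ^ (n % p ^ r) *
      expand K (p ^ r) ((X + C (α ^ p ^ r)) ^ (n / p ^ r)) := by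
    conv_lhs => rw [← Nat.mod_add_div n (p ^ r)]
    rw [pow_add, pow_mul, add_pow_char_pow]
    simp
  rw [taylor_mul, taylor_C, taylor_X_pow, hX, ← mul_assoc]
  refine isSparse_mul_expand hP hd ?_ _
  refine lt_of_le_of_lt (natDegree_C_mul_le _ _) ?_
  refine lt_of_le_of_lt natDegree_pow_le ?_
  rw [natDegree_X_add_C, mul_one]
  exact hf n (mem_support_iff.mp hn)

lemma IsSparse.rootMultiplicity_mod_lt {p r d : ℕ} [hp : Fact p.Prime] [CharP K p]
    (hd : d ≤ p ^ r) {f : K[X]} (hf : IsSparse (p ^ r) d f) (hf0 : f ≠ 0) (α : K) :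
    f.rootMultiplicity α % p ^ r < d := by
  rw [rootMultiplicity_eq_natTrailingDegree]
  refine hf.taylor hd α _ ?_
  rw [taylor_apply]
  exact trailingCoeff_nonzero_iff_nonzero.mpr
    (by rw [← taylor_apply]; exact (taylor_injective α).ne_iff' (map_zero _) |>.mpr hf0)

/-- Sparse polynomials are linearly independent over powers of a polynomial with a simple root. -/
lemma forall_eq_zero_of_sum_sparse_mul_pow {p r d m w : ℕ} [hp : Fact p.Prime] [CharP K p]
    (hdw : d ≤ w) (hmw : m * w < p ^ r) {g : K[X]} {α : K} (hα : g.rootMultiplicity α = 1)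
    (f : Fin m → K[X]) (hf : ∀ i, IsSparse (p ^ r) d (f i))
    (hsum : ∑ i, f i * g ^ ((i : ℕ) * w) = 0) (i : Fin m) : f i = 0 := by
  have hg : g ≠ 0 := by rintro rfl; simp at hα
  have hm : 0 < m := i.pos
  have hpow (n : ℕ) : (g ^ n).rootMultiplicity α = n := by
    rw [← count_roots, roots_pow, Multiset.count_nsmul, count_roots, hα, mul_one]
  have hwP : w < p ^ r := lt_of_le_of_lt (Nat.le_mul_of_pos_left w hm) hmw
  refine (mul_eq_zero.mp (forall_eq_zero_of_sum_eq_zero_of_rootMultiplicity Finset.univ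
    (fun i => f i * g ^ ((i : ℕ) * w)) α ?_ hsum i (Finset.mem_univ i))).resolve_right
    (pow_ne_zero _ hg)
  intro i _ j _ hi0 hj0 hij
  have fi := left_ne_zero_of_mul hi0
  have fj := left_ne_zero_of_mul hj0
  rw [rootMultiplicity_mul hi0, rootMultiplicity_mul hj0, hpow, hpow] at hij
  have ai := (hf i).rootMultiplicity_mod_lt (hdw.trans hwP.le) fi α
  have aj := (hf j).rootMultiplicity_mod_lt (hdw.trans hwP.le) fj α
  have bi : (i : ℕ) * w + w ≤ m * w := by nlinarith [i.isLt]
  have bj : (j : ℕ) * w + w ≤ m * w := by nlinarith [j.isLt]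
  have h1 : ((f i).rootMultiplicity α % p ^ r + i * w) % p ^ r =
      ((f j).rootMultiplicity α % p ^ r + j * w) % p ^ r := by
    rw [Nat.mod_add_mod, Nat.mod_add_mod, hij]
  generalize (f i).rootMultiplicity α % p ^ r = A at *
  generalize (f j).rootMultiplicity α % p ^ r = B at *
  rw [Nat.mod_eq_of_lt (by omega), Nat.mod_eq_of_lt (by omega)] at h1
  have h2 := congrArg (· / w) h1
  have hw : 0 < w := by omega
  refine Fin.ext ?_
  simpa [Nat.add_mul_div_right _ _ hw, Nat.div_eq_of_lt (ai.trans_le hdw),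
    Nat.div_eq_of_lt (aj.trans_le hdw)] using h2

end Sparse

section Stepanov

variable {F : Type*} [Field F]

/-- The auxiliary polynomial of Stepanov's method. -/
noncomputable def stepanovPoly (f : F[X]) (P w D J m : ℕ)
    (l : (Fin D × Fin J × Fin m) × Fin m → F) : F[X] :=
  ∑ s, C (l s) * X ^ ((s.1.1 : ℕ) + s.1.2.1 * P + s.1.2.2 * w) * f ^ ((s.2 : ℕ) * w)

lemma eq_zero_of_sum_C_mul_X_pow {ι : Type*} [Fintype ι] {e : ι → ℕ}
    (he : Function.Injective e) {l : ι → F} (h : ∑ s, C (l s) * X ^ e s = 0) (s : ι) : l s = 0 := by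
  have := congrArg (coeff · (e s)) h
  simpa [finsetSum_coeff, coeff_C_mul, coeff_X_pow, he.eq_iff] using this

lemma stepanov_exponent {P w m a j i : ℕ} (hmw : m * w + 1 = P) (hi : i < m) :
    m - 1 + m * (a + j * P + i * w) = (m * a + (m - 1 - i)) + (m * j + i) * P := by
  obtain ⟨n, rfl⟩ : ∃ n, m = i + n + 1 := ⟨m - 1 - i, by omega⟩
  have e1 : i + n + 1 - 1 - i = n := by omega
  have e2 : i + n + 1 - 1 = i + n := by omega
  rw [e1, e2, ← hmw]
  ring

lemma eq_zero_of_stepanovPoly_eq_zero {p r P w D J m : ℕ} [Fact p.Prime] [CharP F p]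
    (hP : P = p ^ r) (hmw : m * w + 1 = P) (hD : m * D ≤ w)
    {f : F[X]} {u : F} (hu : (expand F m f).rootMultiplicity u = 1)
    {l : (Fin D × Fin J × Fin m) × Fin m → F} (hl : stepanovPoly f P w D J m l = 0) : l = 0 := by
  have h1 : ∑ i' : Fin m, (∑ s : Fin D × Fin J × Fin m, C (l (s, i')) *
      X ^ ((m * (s.1 : ℕ) + (m - 1 - s.2.2)) + (m * s.2.1 + s.2.2) * P)) *
      (expand F m f) ^ ((i' : ℕ) * w) = 0 := by
    have h2 := congrArg (fun g => X ^ (m - 1) * expand F m g) hl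
    simp only [stepanovPoly, map_zero, mul_zero, map_sum, map_mul, map_pow, expand_C, expand_X,
      Finset.mul_sum] at h2
    rw [Fintype.sum_prod_type_right] at h2
    rw [← h2]
    refine Finset.sum_congr rfl fun i' _ => ?_
    rw [Finset.sum_mul]
    refine Finset.sum_congr rfl fun s _ => ?_
    rw [← stepanov_exponent hmw s.2.2.isLt, pow_add, pow_mul]
    ring
  have hwP : m * D ≤ P := by
    rcases Nat.eq_zero_or_pos m with rfl | hm
    · simp
    · nlinarith
  have hlt (s : Fin D × Fin J × Fin m) : m * (s.1 : ℕ) + (m - 1 - s.2.2) < m * D := by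
    have := s.1.isLt
    have := s.2.2.isLt
    have : m * (s.1 : ℕ) + m ≤ m * D := by nlinarith
    omega
  have h3 := forall_eq_zero_of_sum_sparse_mul_pow (p := p) (r := r) hD
    (by rw [← hP]; omega) hu _ ?_ h1
  · funext ⟨s, i'⟩
    refine eq_zero_of_sum_C_mul_X_pow (e := fun s : Fin D × Fin J × Fin m =>
      (m * (s.1 : ℕ) + (m - 1 - s.2.2)) + (m * s.2.1 + s.2.2) * P) ?_ (h3 i') s
    intro s t hst
    have hP0 : 0 < P := by omega
    have hs := (hlt s).trans_le hwP
    have ht := (hlt t).trans_le hwP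
    have hd := congrArg (· / P) hst
    have hr := congrArg (· % P) hst
    simp only [Nat.add_mul_div_right _ _ hP0, Nat.div_eq_of_lt hs, Nat.div_eq_of_lt ht, zero_add,
      Nat.add_mul_mod_self_right, Nat.mod_eq_of_lt hs, Nat.mod_eq_of_lt ht] at hd hr
    have hm : 0 < m := s.2.2.pos
    have d1 := congrArg (· / m) hd
    have d2 := congrArg (· % m) hd
    simp only [Nat.mul_add_div hm, Nat.mul_add_mod, Nat.div_eq_of_lt s.2.2.isLt,
      Nat.div_eq_of_lt t.2.2.isLt, Nat.mod_eq_of_lt s.2.2.isLt,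
      Nat.mod_eq_of_lt t.2.2.isLt, add_zero] at d1 d2
    rw [d2] at hr
    have d3 := Nat.eq_of_mul_eq_mul_left hm (Nat.add_right_cancel hr)
    exact Prod.ext (Fin.ext d3) (Prod.ext (Fin.ext d1) (Fin.ext d2))
  · intro i' n hn
    rw [finsetSum_coeff] at hn
    obtain ⟨s, -, hs⟩ := Finset.exists_ne_zero_of_sum_ne_zero hn
    rw [coeff_C_mul, coeff_X_pow] at hs
    have hn' : n = (m * (s.1 : ℕ) + (m - 1 - s.2.2)) + (m * s.2.1 + s.2.2) * P := by
      by_contra h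
      simp [h] at hs
    rw [hn', ← hP, Nat.add_mul_mod_self_right, Nat.mod_eq_of_lt ((hlt s).trans_le hwP)]
    exact hlt s


lemma map_stepanovPoly {K : Type*} [Field K] (φ : F →+* K) (f : F[X]) (P w D J m : ℕ)
    (l : (Fin D × Fin J × Fin m) × Fin m → F) :
    (stepanovPoly f P w D J m l).map φ = stepanovPoly (f.map φ) P w D J m (fun s => φ (l s)) := by
  simp [stepanovPoly, Polynomial.map_sum]

lemma exists_sum_C_mul_eq_zero {ι : Type*} [Fintype ι] {B : ℕ} (hB : B < Fintype.card ι)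
    (G : ι → F[X]) (hG : ∀ s, (G s).natDegree < B) :
    ∃ l : ι → F, l ≠ 0 ∧ ∑ s, C (l s) * G s = 0 := by
  let G' : ι → degreeLT F B := fun s => ⟨G s, by
    rw [mem_degreeLT]
    exact lt_of_le_of_lt degree_le_natDegree (by exact_mod_cast hG s)⟩
  have h : ¬ LinearIndependent F G' := fun h => by
    have : Module.Finite F (degreeLT F B) := Module.Finite.equiv (degreeLTEquiv F B).symm
    have h1 := h.fintype_card_le_finrank
    rw [(degreeLTEquiv F B).finrank_eq, Module.finrank_fin_fun] at h1
    omega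
  rw [Fintype.not_linearIndependent_iff] at h
  obtain ⟨l, h0, i, hi⟩ := h
  refine ⟨l, fun h => hi (by simp [h]), ?_⟩
  have h1 := congrArg Subtype.val h0
  simpa [G', smul_eq_C_mul] using h1

/-- Simple roots of `f` pull back to simple roots of `expand F m f`. -/
lemma rootMultiplicity_expand_eq_one {m : ℕ} (hm : (m : F) ≠ 0) {f : F[X]} {u : F} (hu : u ≠ 0)
    (hf : f.rootMultiplicity (u ^ m) = 1) : (expand F m f).rootMultiplicity u = 1 := by
  have hm0 : 0 < m := Nat.pos_of_ne_zero (by rintro rfl; simp at hm)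
  have hf0 : f ≠ 0 := by rintro rfl; simp at hf
  have he0 : expand F m f ≠ 0 := (expand_ne_zero hm0).mpr hf0
  have h1 : f.IsRoot (u ^ m) := (rootMultiplicity_pos hf0).mp (by omega)
  have h2 : 0 < (expand F m f).rootMultiplicity u := by
    rw [rootMultiplicity_pos he0, IsRoot, expand_eval]
    exact h1
  have h3 : ¬ 1 < (expand F m f).rootMultiplicity u := by
    rw [one_lt_rootMultiplicity_iff_isRoot he0]
    rintro ⟨-, h⟩
    rw [derivative_expand, IsRoot, eval_mul, expand_eval] at h
    have h4 : (derivative f).eval (u ^ m) ≠ 0 := fun h5 => by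
      have := (one_lt_rootMultiplicity_iff_isRoot hf0).mpr ⟨h1, h5⟩
      omega
    simp [h4, hm, hu] at h
  omega

/-- The companion of `stepanovPoly`: it agrees with its `P`-th power, up to a unit, at the points
to be counted, but has much smaller degree. -/
noncomputable def stepanovDual (f : F[X]) (z₁ z₂ : F) (P w D J m : ℕ)
    (s : (Fin D × Fin J × Fin m) × Fin m) : F[X] :=
  C (z₁ ^ (s.1.2.2 : ℕ) * z₂ ^ (s.2 : ℕ)) *
    (X ^ ((s.1.1 : ℕ) * P + s.1.2.1 + (m - 1 - s.1.2.2) * w) * f ^ ((m - 1 - s.2) * w))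

lemma natDegree_stepanovDual_lt {P w D J m : ℕ} (hmw : m * w + 1 = P) {f : F[X]}
    (hf : f.natDegree ≤ 2) (z₁ z₂ : F) (s : (Fin D × Fin J × Fin m) × Fin m) :
    (stepanovDual f z₁ z₂ P w D J m s).natDegree < D * P + J + 2 * P := by
  obtain ⟨⟨a, j, i⟩, i'⟩ := s
  refine lt_of_le_of_lt (natDegree_C_mul_le _ _) ?_
  refine lt_of_le_of_lt natDegree_mul_le ?_
  rw [natDegree_X_pow]
  have h1 : (f ^ ((m - 1 - (i' : ℕ)) * w)).natDegree ≤ ((m - 1 - (i' : ℕ)) * w) * 2 :=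
    natDegree_pow_le.trans (Nat.mul_le_mul_left _ hf)
  have h2 : (m - 1 - (i : ℕ)) * w ≤ m * w := Nat.mul_le_mul_right _ (by omega)
  have h3 : (m - 1 - (i' : ℕ)) * w ≤ m * w := Nat.mul_le_mul_right _ (by omega)
  have h4 : ((a : ℕ) + 1) * P ≤ D * P := Nat.mul_le_mul_right _ a.isLt
  have h5 := j.isLt
  rw [Nat.add_mul, one_mul] at h4
  dsimp only
  omega

lemma natDegree_stepanovPoly_le {P w D J m : ℕ} (hmw : m * w + 1 = P) {f : F[X]}
    (hf : f.natDegree ≤ 2) (l : (Fin D × Fin J × Fin m) × Fin m → F) :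
    (stepanovPoly f P w D J m l).natDegree ≤ D + (J - 1) * P + 3 * P := by
  refine natDegree_sum_le_of_forall_le _ _ ?_
  rintro ⟨⟨a, j, i⟩, i'⟩ -
  rw [mul_assoc]
  refine (natDegree_C_mul_le _ _).trans ?_
  refine natDegree_mul_le.trans ?_
  rw [natDegree_X_pow]
  have h1 : (f ^ ((i' : ℕ) * w)).natDegree ≤ ((i' : ℕ) * w) * 2 :=
    natDegree_pow_le.trans (Nat.mul_le_mul_left _ hf)
  have h2 : (i : ℕ) * w ≤ m * w := Nat.mul_le_mul_right _ i.isLt.le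
  have h3 : (i' : ℕ) * w ≤ m * w := Nat.mul_le_mul_right _ i'.isLt.le
  have h4 : (j : ℕ) * P ≤ (J - 1) * P := Nat.mul_le_mul_right _ (by omega)
  have := a.isLt
  dsimp only
  omega

lemma stepanov_term {K : Type*} [CommRing K] {x y c z₁ z₂ : K} {P w m a j i i' : ℕ}
    (hi : i < m) (hi' : i' < m) (hx : x ^ (P * P) = x) (h₁ : x ^ (w * (P + 1)) = z₁)
    (h₂ : y ^ (w * (P + 1)) = z₂) (hc : c ^ P = c) :
    (c * x ^ (a + j * P + i * w) * y ^ (i' * w)) ^ P * (x ^ ((m - 1) * w) * y ^ ((m - 1) * w)) =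
      c * (z₁ ^ i * z₂ ^ i' * (x ^ (a * P + j + (m - 1 - i) * w) * y ^ ((m - 1 - i') * w))) := by
  obtain ⟨n, rfl⟩ : ∃ n, m = i + n + 1 := ⟨m - 1 - i, by omega⟩
  obtain ⟨n', hn'⟩ : ∃ n', i + n = i' + n' := ⟨i + n - i', by omega⟩
  have e1 : i + n + 1 - 1 = i + n := by omega
  have e2 : i + n - i = n := by omega
  have e3 : i + n - i' = n' := by omega
  rw [e1, e2, e3, ← h₁, ← h₂]
  have e4 : x ^ ((a + j * P + i * w) * P) * x ^ ((i + n) * w) =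
      (x ^ (w * (P + 1))) ^ i * x ^ (a * P + j + n * w) := by
    rw [← pow_mul, ← pow_add, ← pow_add,
      show (a + j * P + i * w) * P + (i + n) * w = P * P * j + (w * (P + 1) * i + (a * P + n * w)) by ring,
      pow_add, pow_mul x (P * P), hx, ← pow_add]
    congr 1
    ring
  have e5 : y ^ (i' * w * P) * y ^ ((i + n) * w) = (y ^ (w * (P + 1))) ^ i' * y ^ (n' * w) := by
    rw [hn', ← pow_mul, ← pow_add, ← pow_add]
    congr 1
    ring
  rw [mul_pow, mul_pow, hc, ← pow_mul, ← pow_mul]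
  linear_combination c * (y ^ (i' * w * P) * y ^ ((i + n) * w)) * e4 +
    c * ((x ^ (w * (P + 1))) ^ i * x ^ (a * P + j + n * w)) * e5

lemma stepanovPoly_pow_mul_eq [Fintype F] {K : Type*} [Field K] [Fintype K] [Algebra F K]
    {P w m r D J : ℕ} (hP : P = Fintype.card F ^ r) (hK : Fintype.card K = P ^ 2)
    (f : F[X]) {z₁ z₂ : F} {x : K} (hx₁ : x ^ (w * (P + 1)) = algebraMap F K z₁)
    (hx₂ : (aeval x f) ^ (w * (P + 1)) = algebraMap F K z₂)
    (l : (Fin D × Fin J × Fin m) × Fin m → F) :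
    (aeval x (stepanovPoly f P w D J m l)) ^ P *
      (x ^ ((m - 1) * w) * (aeval x f) ^ ((m - 1) * w)) =
      aeval x (∑ s, C (l s) * stepanovDual f z₁ z₂ P w D J m s) := by
  obtain ⟨p, hp⟩ := CharP.exists F
  obtain ⟨n, hpp, hn⟩ := FiniteField.card F p
  have : Fact p.Prime := ⟨hpp⟩
  have hPp : P = p ^ (n * r) := by rw [hP, hn, pow_mul]
  have : CharP K p := charP_of_injective_algebraMap' F p
  have hxQ : x ^ (P * P) = x := by rw [← sq, ← hK]; exact FiniteField.pow_card x
  have hsum (g : (Fin D × Fin J × Fin m) × Fin m → K) : (∑ s, g s) ^ P = ∑ s, g s ^ P := by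
    rw [hPp, sum_pow_char_pow]
  rw [stepanovPoly, map_sum, map_sum, hsum, Finset.sum_mul]
  refine Finset.sum_congr rfl ?_
  rintro ⟨⟨a, j, i⟩, i'⟩ -
  simp only [stepanovDual, map_mul, aeval_C, map_pow, aeval_X]
  refine stepanov_term i.isLt i'.isLt hxQ hx₁ hx₂ ?_
  rw [← map_pow, hP, FiniteField.pow_card_pow]

lemma stepanov_parameters {P w m : ℕ} (hm1 : 0 < m) (hmw : m * w + 1 = P)
    (hlarge : 2 * m ^ 2 + 10 ≤ P) : ∃ D J : ℕ, m * D ≤ w ∧ D * P + J + 2 * P < D * (J * m) * m ∧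
      m ^ 2 * (D + (J - 1) * P + 3 * P) ≤ P ^ 2 + 13 * m ^ 2 * P := by
  have hDw : m * (w / m) ≤ w := Nat.mul_div_le _ _
  have hDw' : w < m * (w / m) + m := Nat.lt_mul_div_succ w hm1
  generalize w / m = D at *
  have hDw2 : P ≤ m ^ 2 * D + m ^ 2 := by nlinarith
  have hJ1 : P < m ^ 2 * (P / m ^ 2) + m ^ 2 := Nat.lt_mul_div_succ P (by positivity)
  have hJ2 : m ^ 2 * (P / m ^ 2) ≤ P := Nat.mul_div_le P (m ^ 2)
  have hJP := Nat.div_le_self P (m ^ 2)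
  generalize P / m ^ 2 = J at *
  refine ⟨D, J + 9, hDw, ?_, ?_⟩
  · have h1 : P + 8 * m ^ 2 ≤ m ^ 2 * (J + 9) := by rw [Nat.mul_add]; omega
    have h2 := Nat.mul_le_mul_left D h1
    have h3 : D * (m ^ 2 * (J + 9)) = D * ((J + 9) * m) * m := by ring
    have h4 : D * (P + 8 * m ^ 2) = D * P + 8 * (m ^ 2 * D) := by ring
    omega
  · have h1 := Nat.mul_le_mul_right P hJ2
    have h2 : D ≤ P := by nlinarith
    have h3 := Nat.mul_le_mul_left (m ^ 2) h2
    rw [show J + 9 - 1 = J + 8 from rfl]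
    nlinarith

lemma stepanov_count [Fintype F] {K : Type*} [Field K] [Fintype K] [Algebra F K] {P w m r : ℕ}
    (hm : m + 1 = Fintype.card F) (hP : P = Fintype.card F ^ r) (hK : Fintype.card K = P ^ 2)
    (hmw : m * w + 1 = P) (hlarge : 2 * m ^ 2 + 10 ≤ P) {f : F[X]} (hfdeg : f.natDegree ≤ 2)
    {α : AlgebraicClosure F} (hα : α ≠ 0)
    (hfα : (f.map (algebraMap F (AlgebraicClosure F))).rootMultiplicity α = 1)
    {z₁ z₂ : F} (hz₁ : z₁ ≠ 0) (hz₂ : z₂ ≠ 0) :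
    m ^ 2 * (Finset.univ.filter fun x : K => x ^ (w * (P + 1)) = algebraMap F K z₁ ∧
      (aeval x f) ^ (w * (P + 1)) = algebraMap F K z₂).card ≤ P ^ 2 + 13 * m ^ 2 * P := by
  obtain ⟨p, hp⟩ := CharP.exists F
  obtain ⟨n, hpp, hn⟩ := FiniteField.card F p
  have : Fact p.Prime := ⟨hpp⟩
  have hPp : P = p ^ (n * r) := by rw [hP, hn, pow_mul]
  have : CharP (AlgebraicClosure F) p := charP_of_injective_algebraMap' F p
  have hmF : (m : F) ≠ 0 := by
    have : ((m + 1 : ℕ) : F) = 0 := by rw [hm]; simp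
    push_cast at this
    rw [eq_neg_of_add_eq_zero_left this]
    simp
  have hm1 : 0 < m := Nat.pos_of_ne_zero (by rintro rfl; simp at hmF)
  obtain ⟨D, J, hDw, hDJ, hcount⟩ := stepanov_parameters hm1 hmw hlarge
  obtain ⟨l, hl0, hl⟩ := exists_sum_C_mul_eq_zero
    (by simp only [Fintype.card_prod, Fintype.card_fin]; exact hDJ) _
    (natDegree_stepanovDual_lt hmw hfdeg z₁ z₂)
  have hΦ0 : stepanovPoly f P w D J m l ≠ 0 := by
    intro h
    obtain ⟨u, hu⟩ := IsAlgClosed.exists_pow_nat_eq α hm1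
    have h1 := congrArg (Polynomial.map (algebraMap F (AlgebraicClosure F))) h
    rw [map_stepanovPoly, Polynomial.map_zero] at h1
    have hu0 : u ≠ 0 := by rintro rfl; rw [zero_pow hm1.ne'] at hu; exact hα hu.symm
    rw [← hu] at hfα
    have h2 := eq_zero_of_stepanovPoly_eq_zero (p := p) hPp hmw hDw
      (rootMultiplicity_expand_eq_one (fun h => hmF ((algebraMap F (AlgebraicClosure F)).injective
        (by simpa using h))) hu0 hfα) h1
    exact hl0 (funext fun s => (algebraMap F (AlgebraicClosure F)).injective
      (by simpa using congrFun h2 s))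
  have hcard : (Finset.univ.filter fun x : K => x ^ (w * (P + 1)) = algebraMap F K z₁ ∧
      (aeval x f) ^ (w * (P + 1)) = algebraMap F K z₂).card ≤
      (stepanovPoly f P w D J m l).natDegree := by
    rw [← natDegree_map (algebraMap F K)]
    refine card_le_degree_of_subset_roots fun x hx => ?_
    rw [Finset.mem_val, Finset.mem_filter] at hx
    obtain ⟨-, hx1, hx2⟩ := hx
    rw [mem_roots ((Polynomial.map_ne_zero_iff (algebraMap F K).injective).mpr hΦ0), IsRoot,
      eval_map_algebraMap]
    have hwP : w * (P + 1) ≠ 0 := by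
      have : w ≠ 0 := by rintro rfl; omega
      positivity
    have hne {y : K} {z : F} (hz : z ≠ 0) (h : y ^ (w * (P + 1)) = algebraMap F K z) : y ≠ 0 := by
      rintro rfl
      rw [zero_pow hwP, eq_comm, map_eq_zero] at h
      exact hz h
    have key := stepanovPoly_pow_mul_eq hP hK f hx1 hx2 l
    rw [hl, map_zero] at key
    rcases mul_eq_zero.mp key with h | h
    · exact pow_eq_zero_iff (by omega) |>.mp h
    · exact absurd h (mul_ne_zero (pow_ne_zero _ (hne hz₁ hx1)) (pow_ne_zero _ (hne hz₂ hx2)))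
  exact (Nat.mul_le_mul_left _ (hcard.trans (natDegree_stepanovPoly_le hmw hfdeg l))).trans hcount

end Stepanov

section CharSum

lemma norm_mulChar_le_one {F : Type*} [Field F] [Fintype F] (χ : MulChar F ℂ) (z : F) :
    ‖χ z‖ ≤ 1 := by
  by_cases hz : z = 0
  · simp [hz, MulChar.map_zero]
  · have h1 : z ^ (Fintype.card F - 1) = 1 := FiniteField.pow_card_sub_one_eq_one z hz
    have h2 := congrArg χ h1
    rw [map_pow, map_one] at h2
    refine (Complex.norm_eq_one_of_pow_eq_one h2 ?_).le
    have := Fintype.one_lt_card (α := F)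
    omega

lemma norm_sum_mulChar_le_of_card_le {F K : Type*} [Field F] [Fintype F] [Fintype K]
    (χ ψ : MulChar F ℂ) (h : χ ≠ 1 ∨ ψ ≠ 1) (a b : K → F) (U V : ℝ)
    (hU : ∀ z₁ z₂ : F, z₁ ≠ 0 → z₂ ≠ 0 →
      ((Finset.univ.filter fun x => a x = z₁ ∧ b x = z₂).card : ℝ) ≤ U)
    (hV : (Fintype.card F - 1 : ℝ) ^ 2 * U -
      (Finset.univ.filter fun x => a x ≠ 0 ∧ b x ≠ 0).card ≤ V) :
    ‖∑ x, χ (a x) * ψ (b x)‖ ≤ V := by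
  set T : Finset F := Finset.univ.erase 0 with hT
  have hsumT (θ : MulChar F ℂ) : ∑ z ∈ T, θ z = ∑ z, θ z := by
    rw [hT, ← Finset.add_sum_erase Finset.univ (fun z => θ z) (Finset.mem_univ 0)]
    simp [MulChar.map_zero]
  have hcardT : (T.card : ℝ) = Fintype.card F - 1 := by
    rw [hT, Finset.card_erase_of_mem (Finset.mem_univ 0), Finset.card_univ,
      Nat.cast_sub Fintype.card_pos, Nat.cast_one]
  set M : F → F → ℕ := fun z₁ z₂ => (Finset.univ.filter fun x => a x = z₁ ∧ b x = z₂).card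
  have hmem {z : F} : z ∈ T ↔ z ≠ 0 := by simp [hT]
  have hfib {R : Type} [CommRing R] (g : F → F → R) (hg : ∀ z₁ z₂, z₁ = 0 ∨ z₂ = 0 → g z₁ z₂ = 0) :
      ∑ x, g (a x) (b x) = ∑ z₁ ∈ T, ∑ z₂ ∈ T, (M z₁ z₂ : R) * g z₁ z₂ := by
    have h1 (z₁ z₂ : F) : (M z₁ z₂ : R) * g z₁ z₂ =
        ∑ x, if a x = z₁ ∧ b x = z₂ then g z₁ z₂ else 0 := by
      rw [← Finset.sum_filter, Finset.sum_const, nsmul_eq_mul]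
    simp_rw [h1]
    have h2 (z₁ : F) : ∑ z₂ ∈ T, ∑ x, (if a x = z₁ ∧ b x = z₂ then g z₁ z₂ else 0) =
        ∑ x, ∑ z₂ ∈ T, if a x = z₁ ∧ b x = z₂ then g z₁ z₂ else 0 := Finset.sum_comm
    simp_rw [h2]
    rw [Finset.sum_comm]
    refine Finset.sum_congr rfl fun x _ => ?_
    simp_rw [ite_and]
    have h3 (z₁ : F) : ∑ z₂ ∈ T, (if a x = z₁ then if b x = z₂ then g z₁ z₂ else 0 else 0) =
        if a x = z₁ then (if b x ∈ T then g z₁ (b x) else 0) else 0 := by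
      split_ifs with h1 h2
      · rw [Finset.sum_ite_eq, if_pos h2]
      · rw [Finset.sum_ite_eq, if_neg h2]
      · simp
    simp_rw [h3]
    rw [Finset.sum_ite_eq]
    by_cases h4 : a x = 0
    · simp [h4, hg, hT]
    · by_cases h5 : b x = 0
      · simp [h5, hg, hT]
      · simp [h4, h5, hT]
  have h0 : ∑ z₁ ∈ T, ∑ z₂ ∈ T, χ z₁ * ψ z₂ = 0 := by
    rw [← Finset.sum_mul_sum, hsumT, hsumT]
    rcases h with h | h
    · rw [MulChar.sum_eq_zero_of_ne_one h, zero_mul]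
    · rw [MulChar.sum_eq_zero_of_ne_one h, mul_zero]
  have h1 : ∑ x, χ (a x) * ψ (b x) =
      -∑ z₁ ∈ T, ∑ z₂ ∈ T, ((U - M z₁ z₂ : ℝ) : ℂ) * (χ z₁ * ψ z₂) := by
    rw [hfib (fun z₁ z₂ => χ z₁ * ψ z₂) (by rintro z₁ z₂ (rfl | rfl) <;> simp [MulChar.map_zero])]
    push_cast
    simp_rw [sub_mul, Finset.sum_sub_distrib]
    have h2 : ∑ z₁ ∈ T, ∑ z₂ ∈ T, (U : ℂ) * (χ z₁ * ψ z₂) = 0 := by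
      have h3 : ∑ z₁ ∈ T, ∑ z₂ ∈ T, (U : ℂ) * (χ z₁ * ψ z₂) =
          U * ∑ z₁ ∈ T, ∑ z₂ ∈ T, χ z₁ * ψ z₂ := by
        rw [Finset.mul_sum]
        exact Finset.sum_congr rfl fun z₁ _ => (Finset.mul_sum _ _ _).symm
      rw [h3, h0, mul_zero]
    rw [h2]
    ring
  rw [h1, norm_neg]
  refine le_trans ?_ hV
  have h2 : ((Finset.univ.filter fun x => a x ≠ 0 ∧ b x ≠ 0).card : ℝ) =
      ∑ z₁ ∈ T, ∑ z₂ ∈ T, (M z₁ z₂ : ℝ) := by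
    have := hfib (R := ℝ) (fun z₁ z₂ => if z₁ ≠ 0 ∧ z₂ ≠ 0 then 1 else 0)
      (by rintro z₁ z₂ (rfl | rfl) <;> simp)
    rw [Finset.sum_boole] at this
    rw [this]
    refine Finset.sum_congr rfl fun z₁ h1 => Finset.sum_congr rfl fun z₂ h2 => ?_
    rw [if_pos ⟨hmem.mp h1, hmem.mp h2⟩, mul_one]
  have h3 : (Fintype.card F - 1 : ℝ) ^ 2 * U = ∑ z₁ ∈ T, ∑ z₂ ∈ T, U := by
    simp only [Finset.sum_const, nsmul_eq_mul, hcardT]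
    ring
  rw [h2, h3, ← Finset.sum_sub_distrib]
  simp_rw [← Finset.sum_sub_distrib]
  refine (norm_sum_le _ _).trans (Finset.sum_le_sum fun z₁ h1 => ?_)
  refine (norm_sum_le _ _).trans (Finset.sum_le_sum fun z₂ h2 => ?_)
  rw [norm_mul, norm_mul, Complex.norm_real, Real.norm_of_nonneg
    (sub_nonneg.mpr (hU z₁ z₂ (hmem.mp h1) (hmem.mp h2)))]
  refine mul_le_of_le_one_right (sub_nonneg.mpr (hU z₁ z₂ (hmem.mp h1) (hmem.mp h2))) ?_
  exact mul_le_one₀ (norm_mulChar_le_one _ _) (norm_nonneg _) (norm_mulChar_le_one _ _)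

lemma norm_sum_norm_le_of_stepanov {F K : Type*} [Field F] [Fintype F] [Field K] [Fintype K]
    [Algebra F K] {P r : ℕ} (hP : P = Fintype.card F ^ r)
    (hK : Fintype.card K = P ^ 2) (hlarge : 2 * (Fintype.card F - 1) ^ 2 + 10 ≤ P) {f : F[X]}
    (hfdeg : f.natDegree ≤ 2) {α : AlgebraicClosure F} (hα : α ≠ 0)
    (hfα : (f.map (algebraMap F (AlgebraicClosure F))).rootMultiplicity α = 1)
    (χ ψ : MulChar F ℂ) (h : χ ≠ 1 ∨ ψ ≠ 1) :
    ‖∑ x : K, χ (Algebra.norm F x) * ψ (Algebra.norm F (aeval x f))‖ ≤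
      (13 * (Fintype.card F : ℝ) ^ 2 + 3) * P := by
  have hF1 := Fintype.one_lt_card (α := F)
  obtain ⟨m, hm⟩ : ∃ m, m + 1 = Fintype.card F := ⟨Fintype.card F - 1, by omega⟩
  have hm0 : 0 < m := by omega
  have hmP : m ∣ P - 1 := by
    have := Nat.sub_dvd_pow_sub_pow (Fintype.card F) 1 r
    rwa [one_pow, ← hP, ← hm, Nat.add_sub_cancel] at this
  obtain ⟨w, hw⟩ := hmP
  have hmw : m * w + 1 = P := by omega
  rw [← hm, Nat.add_sub_cancel] at hlarge
  have hexp : (Nat.card K - 1) / (Nat.card F - 1) = w * (P + 1) := by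
    rw [Nat.card_eq_fintype_card, Nat.card_eq_fintype_card, hK, ← hm, Nat.add_sub_cancel, ← hmw]
    refine Nat.div_eq_of_eq_mul_right hm0 ?_
    rw [Nat.sub_eq_iff_eq_add (Nat.one_le_pow 2 (m * w + 1) (Nat.succ_pos _))]
    ring
  have hnorm (x : K) (z : F) : Algebra.norm F x = z ↔ x ^ (w * (P + 1)) = algebraMap F K z := by
    rw [← hexp, ← FiniteField.algebraMap_norm_eq_pow, (algebraMap F K).injective.eq_iff]
  have hcardF : (Fintype.card F : ℝ) = m + 1 := by rw [← hm]; push_cast; ring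
  have hm0' : (0 : ℝ) < m := by exact_mod_cast hm0
  refine norm_sum_mulChar_le_of_card_le χ ψ h _ _ ((P : ℝ) ^ 2 / m ^ 2 + 13 * P) _ ?_ ?_
  · intro z₁ z₂ h₁ h₂
    simp_rw [hnorm]
    have := stepanov_count hm hP hK hmw hlarge hfdeg hα hfα h₁ h₂
    have h3 : ((m ^ 2 * (Finset.univ.filter fun x : K => x ^ (w * (P + 1)) = algebraMap F K z₁ ∧
      (aeval x f) ^ (w * (P + 1)) = algebraMap F K z₂).card : ℕ) : ℝ) ≤
        ((P ^ 2 + 13 * m ^ 2 * P : ℕ) : ℝ) := by exact_mod_cast this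
    push_cast at h3
    rw [← mul_le_mul_iff_right₀ (show (0 : ℝ) < (m : ℝ) ^ 2 by positivity)]
    refine h3.trans_eq ?_
    field_simp
  · have hf0 : f ≠ 0 := by rintro rfl; simp at hfα
    have h1 : (Finset.univ.filter fun x : K =>
        ¬ (Algebra.norm F x ≠ 0 ∧ Algebra.norm F (aeval x f) ≠ 0)).card ≤ 3 := by
      have h2 : (Finset.univ.filter fun x : K =>
          ¬ (Algebra.norm F x ≠ 0 ∧ Algebra.norm F (aeval x f) ≠ 0)) ⊆
          insert 0 (f.map (algebraMap F K)).roots.toFinset := by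
        intro x hx
        rw [Finset.mem_filter, not_and_or, not_not, not_not, Algebra.norm_eq_zero_iff,
          Algebra.norm_eq_zero_iff] at hx
        rw [Finset.mem_insert, Multiset.mem_toFinset,
          mem_roots ((Polynomial.map_ne_zero_iff (algebraMap F K).injective).mpr hf0), IsRoot,
          eval_map_algebraMap]
        exact hx.2
      refine (Finset.card_le_card h2).trans ((Finset.card_insert_le _ _).trans ?_)
      have h3 := Multiset.toFinset_card_le (f.map (algebraMap F K)).roots
      have h4 := card_roots' (f.map (algebraMap F K))
      rw [natDegree_map] at h4
      omega
    have h2 := Finset.card_filter_add_card_filter_not (s := (Finset.univ : Finset K)) (fun x : K =>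
      Algebra.norm F x ≠ 0 ∧ Algebra.norm F (aeval x f) ≠ 0)
    rw [Finset.card_univ, hK] at h2
    have h3 : (P : ℝ) ^ 2 ≤ (Finset.univ.filter fun x : K =>
        Algebra.norm F x ≠ 0 ∧ Algebra.norm F (aeval x f) ≠ 0).card + 3 := by
      have : P ^ 2 ≤ (Finset.univ.filter fun x : K =>
        Algebra.norm F x ≠ 0 ∧ Algebra.norm F (aeval x f) ≠ 0).card + 3 := by omega
      exact_mod_cast this
    have h4 : (Fintype.card F - 1 : ℝ) ^ 2 * ((P : ℝ) ^ 2 / m ^ 2 + 13 * P) =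
        P ^ 2 + 13 * m ^ 2 * P := by
      rw [hcardF]
      field_simp
      ring
    rw [h4, hcardF]
    have hP1 : (1 : ℝ) ≤ P := by exact_mod_cast (by omega : 1 ≤ P)
    nlinarith [mul_pos hm0' (lt_of_lt_of_le one_pos hP1)]

end CharSum

section FrobeniusOrbit

lemma mem_range_of_pow_card_eq_self {K L : Type*} [Field K] [Fintype K] [Field L] (σ : K →+* L)
    {y : L} (hy : y ^ Fintype.card K = y) : ∃ z, σ z = y := by
  have h0 : (X ^ Fintype.card K - X : L[X]) ≠ 0 :=
    FiniteField.X_pow_card_sub_X_ne_zero L Fintype.one_lt_card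
  have h1 : Finset.univ.image σ = (X ^ Fintype.card K - X : L[X]).roots.toFinset := by
    refine Finset.eq_of_subset_of_card_le (fun z hz => ?_) ?_
    · rw [Finset.mem_image] at hz
      obtain ⟨w, -, rfl⟩ := hz
      rw [Multiset.mem_toFinset, mem_roots h0]
      simp [← map_pow, FiniteField.pow_card]
    · rw [Finset.card_image_of_injective _ σ.injective, Finset.card_univ]
      refine (Multiset.toFinset_card_le _).trans ((card_roots' _).trans ?_)
      rw [FiniteField.X_pow_card_sub_X_natDegree_eq L Fintype.one_lt_card]
  have h2 : y ∈ (X ^ Fintype.card K - X : L[X]).roots.toFinset := by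
    rw [Multiset.mem_toFinset, mem_roots h0]
    simp [hy]
  rw [← h1, Finset.mem_image] at h2
  obtain ⟨z, -, hz⟩ := h2
  exact ⟨z, hz⟩

variable {L : Type*} [Field L]

/-- The product of `X - C y` over the first `j` points `y` of the orbit of `x` under `φ`. -/
noncomputable def orbitPoly (φ : L →+* L) (j : ℕ) (x : L) : L[X] :=
  ∏ i ∈ Finset.range j, (X - C (φ^[i] x))

lemma orbitPoly_monic (φ : L →+* L) (j : ℕ) (x : L) : (orbitPoly φ j x).Monic :=
  monic_prod_X_sub_C _ _

lemma natDegree_orbitPoly (φ : L →+* L) (j : ℕ) (x : L) : (orbitPoly φ j x).natDegree = j := by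
  rw [orbitPoly, natDegree_finsetProd_X_sub_C_eq_card, Finset.card_range]

lemma X_sub_C_dvd_orbitPoly (φ : L →+* L) {j : ℕ} (hj : 0 < j) (x : L) :
    X - C x ∣ orbitPoly φ j x := by
  have h := Finset.dvd_prod_of_mem (fun i => X - C (φ^[i] x)) (Finset.mem_range.mpr hj)
  rw [Function.iterate_zero_apply] at h
  exact h

lemma map_orbitPoly (φ : L →+* L) {j : ℕ} {x : L} (hx : φ^[j] x = x) :
    (orbitPoly φ j x).map φ = orbitPoly φ j x := by
  rcases Nat.eq_zero_or_pos j with rfl | hj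
  · simp [orbitPoly]
  obtain ⟨k, rfl⟩ : ∃ k, j = k + 1 := ⟨j - 1, by omega⟩
  rw [orbitPoly, Polynomial.map_prod]
  simp only [Polynomial.map_sub, map_X, map_C, ← Function.iterate_succ_apply' φ]
  rw [Finset.prod_range_succ, Finset.prod_range_succ', hx]
  simp

lemma orbitPoly_mul (φ : L →+* L) {d : ℕ} {x : L} (hx : φ^[d] x = x) (e : ℕ) :
    orbitPoly φ (d * e) x = orbitPoly φ d x ^ e := by
  induction e with
  | zero => simp [orbitPoly]
  | succ e ih =>
    rw [pow_succ, ← ih, Nat.mul_succ]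
    simp only [orbitPoly, Finset.prod_range_add]
    congr 1
    refine Finset.prod_congr rfl fun i _ => ?_
    rw [Nat.add_comm, Function.iterate_add_apply]
    have h : Function.IsPeriodicPt φ (d * e) x := Function.IsPeriodicPt.mul_const hx e
    rw [h]

lemma orbitPoly_pow_dvd_iff {φ : L →+* L} {H : L[X]} (hH0 : H ≠ 0) (hH : H.map φ = H) {x : L}
    (hd : 0 < Function.minimalPeriod φ x) (e : ℕ) :
    orbitPoly φ (Function.minimalPeriod φ x) x ^ e ∣ H ↔ e ≤ H.rootMultiplicity x := by
  rw [le_rootMultiplicity_iff hH0]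
  constructor
  · intro h
    exact dvd_trans (pow_dvd_pow_of_dvd (X_sub_C_dvd_orbitPoly φ hd x) e) h
  · intro h
    rw [orbitPoly, ← Finset.prod_pow]
    refine Finset.prod_dvd_of_coprime (fun i hi j hj hij => ?_) fun i hi => ?_
    · refine IsCoprime.pow (isCoprime_X_sub_C_of_isUnit_sub ?_)
      rw [isUnit_iff_ne_zero, sub_ne_zero]
      intro h1
      simp only [Finset.coe_range, Set.mem_Iio] at hi hj
      exact hij (Function.iterate_injOn_Iio_minimalPeriod hi hj h1)
    · clear hi
      induction i with
      | zero => exact h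
      | succ i ih =>
        have h2 := _root_.map_dvd (mapRingHom φ) ih
        simpa [hH, ← Function.iterate_succ_apply' φ] using h2

lemma sum_card_orbitPoly_dvd [IsAlgClosed L] {φ : L →+* L} {H : L[X]} (hH0 : H ≠ 0)
    (hH : H.map φ = H) (Z : ℕ → Finset L) (hZ : ∀ j, 0 < j → ∀ x, x ∈ Z j ↔ φ^[j] x = x) :
    ∑ j ∈ Finset.Icc 1 H.natDegree, ((Z j).filter fun x => orbitPoly φ j x ∣ H).card =
      H.natDegree := by
  have hper (x : L) (hx : x ∈ H.roots.toFinset) : 0 < Function.minimalPeriod φ x := by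
    have hmaps : Set.MapsTo φ (H.roots.toFinset : Set L) (H.roots.toFinset : Set L) := by
      intro y hy
      simp only [Finset.mem_coe, Multiset.mem_toFinset, mem_roots hH0, IsRoot] at hy ⊢
      rw [← hH, eval_map, eval₂_hom, hy, map_zero]
    have hinj : Function.Injective (hmaps.restrict φ _ _) :=
      hmaps.restrict_inj.mpr φ.injective.injOn
    obtain ⟨n, hn, h⟩ := hinj.mem_periodicPts ⟨x, hx⟩
    refine Function.IsPeriodicPt.minimalPeriod_pos hn (?_ : φ^[n] x = x)
    have h1 := congrArg Subtype.val h
    rw [hmaps.iterate_restrict] at h1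
    exact h1
  have hset (j : ℕ) (hj : j ∈ Finset.Icc 1 H.natDegree) :
      (Z j).filter (fun x => orbitPoly φ j x ∣ H) =
        H.roots.toFinset.filter (fun x => φ^[j] x = x ∧ orbitPoly φ j x ∣ H) := by
    rw [Finset.mem_Icc] at hj
    ext x
    simp only [Finset.mem_filter, hZ j hj.1]
    refine ⟨fun h => ⟨?_, h⟩, fun h => h.2⟩
    rw [Multiset.mem_toFinset, mem_roots hH0, ← dvd_iff_isRoot]
    exact (X_sub_C_dvd_orbitPoly φ hj.1 x).trans h.2
  rw [Finset.sum_congr rfl fun j hj => congrArg Finset.card (hset j hj)]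
  simp_rw [Finset.card_filter]
  rw [Finset.sum_comm]
  simp_rw [← Finset.card_filter]
  have hcard (x : L) (hx : x ∈ H.roots.toFinset) : ((Finset.Icc 1 H.natDegree).filter fun j =>
      φ^[j] x = x ∧ orbitPoly φ j x ∣ H).card = H.roots.count x := by
    have hd := hper x hx
    rw [count_roots, ← Nat.card_Icc 1 (H.rootMultiplicity x) |>.trans (Nat.add_sub_cancel ..)]
    rw [← Finset.card_image_of_injective (Finset.Icc 1 (H.rootMultiplicity x))
      (mul_right_injective₀ hd.ne')]
    congr 1
    ext j
    simp only [Finset.mem_filter, Finset.mem_Icc, Finset.mem_image]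
    have hdx : φ^[Function.minimalPeriod φ x] x = x := Function.iterate_minimalPeriod
    constructor
    · rintro ⟨⟨h1, h2⟩, h3, h4⟩
      obtain ⟨e, rfl⟩ := Function.isPeriodicPt_iff_minimalPeriod_dvd.mp h3
      rw [orbitPoly_mul φ hdx, orbitPoly_pow_dvd_iff hH0 hH hd] at h4
      exact ⟨e, ⟨Nat.pos_of_ne_zero (by rintro rfl; simp at h1), h4⟩, rfl⟩
    · rintro ⟨e, ⟨h1, h2⟩, rfl⟩
      have h3 : orbitPoly φ (Function.minimalPeriod φ x * e) x ∣ H := by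
        rwa [orbitPoly_mul φ hdx, orbitPoly_pow_dvd_iff hH0 hH hd]
      have h4 := natDegree_le_of_dvd h3 hH0
      rw [natDegree_orbitPoly] at h4
      exact ⟨⟨Nat.mul_pos hd h1, h4⟩,
        Function.isPeriodicPt_iff_minimalPeriod_dvd.mpr (dvd_mul_right _ _), h3⟩
  rw [Finset.sum_congr rfl hcard, Multiset.toFinset_sum_count_eq]
  exact (IsAlgClosed.splits H).natDegree_eq_card_roots.symm

end FrobeniusOrbit

section LFunction

variable {F : Type*} [Field F]

lemma algebraMap_resultant {L : Type*} [Field L] [IsAlgClosed L] [Algebra F L] {h : F[X]}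
    (hh : h.Monic) (g : F[X]) :
    algebraMap F L (resultant h g) =
      ((h.map (algebraMap F L)).roots.map fun r => aeval r g).prod := by
  rw [← resultant_map_map]
  have h1 := resultant_eq_prod_eval (h.map (algebraMap F L)) (g.map (algebraMap F L)) g.natDegree
    (natDegree_map_le) (IsAlgClosed.splits _)
  rw [natDegree_map, (hh.map _).leadingCoeff, one_pow, one_mul] at h1
  rw [h1]
  simp [eval_map_algebraMap]

lemma resultant_mul_left_of_monic {h₁ h₂ : F[X]} (hh₁ : h₁.Monic) (hh₂ : h₂.Monic) (g : F[X]) :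
    resultant (h₁ * h₂) g = resultant h₁ g * resultant h₂ g := by
  rw [hh₁.natDegree_mul hh₂]
  exact resultant_mul_left h₁ h₂ g _ le_rfl

/-- The completely multiplicative function on monic polynomials attached to `χ(x) ψ(f(x))`. -/
noncomputable def resChar (χ ψ : MulChar F ℂ) (f h : F[X]) : ℂ :=
  χ (resultant h X) * ψ (resultant h f)

lemma resChar_mul (χ ψ : MulChar F ℂ) (f : F[X]) {h₁ h₂ : F[X]} (hh₁ : h₁.Monic)
    (hh₂ : h₂.Monic) : resChar χ ψ f (h₁ * h₂) = resChar χ ψ f h₁ * resChar χ ψ f h₂ := by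
  simp only [resChar]
  rw [resultant_mul_left_of_monic hh₁ hh₂, resultant_mul_left_of_monic hh₁ hh₂, map_mul, map_mul]
  ring

lemma resChar_one (χ ψ : MulChar F ℂ) (f : F[X]) : resChar χ ψ f 1 = 1 := by
  have h (g : F[X]) : resultant 1 g = 1 := by
    apply (algebraMap F (AlgebraicClosure F)).injective
    rw [algebraMap_resultant monic_one]
    simp
  rw [resChar, h, h, map_one, map_one, one_mul]

variable [Fintype F]

/-- The Frobenius of the algebraic closure of `F`. -/
noncomputable abbrev frobClosure (F : Type*) [Field F] [Fintype F] :
    AlgebraicClosure F →+* AlgebraicClosure F :=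
  (FiniteField.frobeniusAlgHom F (AlgebraicClosure F)).toRingHom

lemma frobClosure_iterate (i : ℕ) (x : AlgebraicClosure F) :
    (frobClosure F)^[i] x = x ^ Fintype.card F ^ i := by
  have : ⇑(frobClosure F) = (· ^ Fintype.card F) := rfl
  rw [this, pow_iterate]

/-- The fixed points of the `j`-th power of Frobenius. -/
noncomputable def frobFixed (F : Type*) [Field F] [Fintype F] (j : ℕ) :
    Finset (AlgebraicClosure F) :=
  (X ^ Fintype.card F ^ j - X : (AlgebraicClosure F)[X]).roots.toFinset

lemma mem_frobFixed {j : ℕ} (hj : 0 < j) (x : AlgebraicClosure F) :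
    x ∈ frobFixed F j ↔ (frobClosure F)^[j] x = x := by
  have h0 : (X ^ Fintype.card F ^ j - X : (AlgebraicClosure F)[X]) ≠ 0 :=
    FiniteField.X_pow_card_sub_X_ne_zero _ (Nat.one_lt_pow hj.ne' Fintype.one_lt_card)
  rw [frobFixed, Multiset.mem_toFinset, mem_roots h0, frobClosure_iterate]
  simp [sub_eq_zero]

lemma exists_map_eq_of_map_frobClosure {h : (AlgebraicClosure F)[X]} (hh : h.Monic)
    (hφ : h.map (frobClosure F) = h) :
    ∃ g : F[X], g.map (algebraMap F (AlgebraicClosure F)) = h ∧ g.natDegree = h.natDegree ∧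
      g.Monic := by
  refine lifts_and_natDegree_eq_and_monic ?_ hh
  rw [lifts_iff_coeff_lifts]
  intro n
  refine mem_range_of_pow_card_eq_self (algebraMap F (AlgebraicClosure F)) ?_
  have := congrArg (coeff · n) hφ
  simpa using this

lemma exists_map_eq_orbitPoly {j : ℕ} (hj : 0 < j) {x : AlgebraicClosure F}
    (hx : x ∈ frobFixed F j) :
    ∃ g : F[X], g.map (algebraMap F (AlgebraicClosure F)) = orbitPoly (frobClosure F) j x ∧
      g.natDegree = j ∧ g.Monic := by
  have h := exists_map_eq_of_map_frobClosure (orbitPoly_monic (frobClosure F) j x)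
    (map_orbitPoly _ ((mem_frobFixed hj x).mp hx))
  rwa [natDegree_orbitPoly] at h

/-- The descent of `orbitPoly` to `F`. -/
noncomputable def orbitPolyBase (F : Type*) [Field F] [Fintype F] (j : ℕ)
    (x : AlgebraicClosure F) : F[X] :=
  if h : 0 < j ∧ x ∈ frobFixed F j then (exists_map_eq_orbitPoly h.1 h.2).choose else 1

lemma orbitPolyBase_spec {j : ℕ} (hj : 0 < j) {x : AlgebraicClosure F} (hx : x ∈ frobFixed F j) :
    (orbitPolyBase F j x).map (algebraMap F (AlgebraicClosure F)) =
      orbitPoly (frobClosure F) j x ∧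
      (orbitPolyBase F j x).natDegree = j ∧ (orbitPolyBase F j x).Monic := by
  rw [orbitPolyBase, dif_pos ⟨hj, hx⟩]
  exact (exists_map_eq_orbitPoly hj hx).choose_spec

/-- The `j`-th power sum of the `L`-function, as a sum over points. -/
noncomputable def pointSum (χ ψ : MulChar F ℂ) (f : F[X]) (j : ℕ) : ℂ :=
  ∑ x ∈ frobFixed F j, resChar χ ψ f (orbitPolyBase F j x)

lemma resultant_orbitPolyBase {K : Type*} [Field K] [Fintype K] [Algebra F K] {j : ℕ}
    (hj : 0 < j) (hK : Fintype.card K = Fintype.card F ^ j) (σ : K →ₐ[F] AlgebraicClosure F)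
    {x : K} (hx : σ x ∈ frobFixed F j) (g : F[X]) :
    resultant (orbitPolyBase F j (σ x)) g = Algebra.norm F (aeval x g) := by
  apply (algebraMap F (AlgebraicClosure F)).injective
  obtain ⟨h1, h2, h3⟩ := orbitPolyBase_spec hj hx
  have h5 := roots_multiset_prod_X_sub_C
    ((Finset.range j).val.map fun i => (frobClosure F)^[i] (σ x))
  rw [Multiset.map_map] at h5
  have h6 : (orbitPoly (frobClosure F) j (σ x)).roots =
    (Finset.range j).val.map fun i => (frobClosure F)^[i] (σ x) := h5
  rw [algebraMap_resultant h3, h1, h6, Multiset.map_map]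
  have h4 : algebraMap F (AlgebraicClosure F) (Algebra.norm F (aeval x g)) =
      σ (algebraMap F K (Algebra.norm F (aeval x g))) := (σ.commutes _).symm
  rw [h4, FiniteField.algebraMap_norm_eq_pow, map_pow, Nat.card_eq_fintype_card,
    Nat.card_eq_fintype_card, hK, ← Nat.geomSum_eq Fintype.one_lt_card]
  rw [← Finset.prod_pow_eq_pow_sum, ← aeval_algHom_apply]
  refine Finset.prod_congr rfl fun i _ => ?_
  rw [Function.comp_apply, ← frobClosure_iterate]
  clear ‹i ∈ _›
  induction i with
  | zero => rfl
  | succ i ih =>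
    rw [Function.iterate_succ_apply', Function.iterate_succ_apply', ← ih]
    exact aeval_algHom_apply (FiniteField.frobeniusAlgHom F (AlgebraicClosure F)) _ g

lemma sum_norm_eq_pointSum {K : Type*} [Field K] [Fintype K] [Algebra F K] {j : ℕ}
    (hj : 0 < j) (hK : Fintype.card K = Fintype.card F ^ j) (χ ψ : MulChar F ℂ) (f : F[X]) :
    ∑ x : K, χ (Algebra.norm F x) * ψ (Algebra.norm F (aeval x f)) = pointSum χ ψ f j := by
  have : Module.Finite F K := Module.Finite.of_finite
  let σ : K →ₐ[F] AlgebraicClosure F := IsAlgClosed.lift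
  have hσ (x : K) : σ x ∈ frobFixed F j := by
    rw [mem_frobFixed hj, frobClosure_iterate, ← hK, ← map_pow, FiniteField.pow_card]
  refine Finset.sum_bij (fun x _ => σ x) (fun x _ => hσ x) (fun x _ y _ h => σ.injective h)
    (fun y hy => ?_) fun x _ => ?_
  · rw [mem_frobFixed hj, frobClosure_iterate, ← hK] at hy
    obtain ⟨z, hz⟩ := mem_range_of_pow_card_eq_self (σ : K →+* AlgebraicClosure F) hy
    exact ⟨z, Finset.mem_univ z, hz⟩
  · rw [resChar, resultant_orbitPolyBase hj hK σ (hσ x), resultant_orbitPolyBase hj hK σ (hσ x),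
      aeval_X]

lemma finite_monic_natDegree (n : ℕ) : {h : F[X] | h.Monic ∧ h.natDegree = n}.Finite := by
  have : Module.Finite F (degreeLT F n) := Module.Finite.equiv (degreeLTEquiv F n).symm
  have : Finite (degreeLT F n) := Module.finite_of_finite F
  exact Set.finite_coe_iff.mp (Finite.of_equiv _ (monicEquivDegreeLT n).symm)

/-- The monic polynomials of degree `n`. -/
noncomputable def monicFinset (F : Type*) [Field F] [Fintype F] (n : ℕ) : Finset F[X] :=
  (finite_monic_natDegree n).toFinset

lemma mem_monicFinset {n : ℕ} {h : F[X]} : h ∈ monicFinset F n ↔ h.Monic ∧ h.natDegree = n := by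
  simp [monicFinset]

/-- The coefficients of the `L`-function. -/
noncomputable def lCoeff (χ ψ : MulChar F ℂ) (f : F[X]) (n : ℕ) : ℂ :=
  ∑ h ∈ monicFinset F n, resChar χ ψ f h

lemma lCoeff_zero (χ ψ : MulChar F ℂ) (f : F[X]) : lCoeff χ ψ f 0 = 1 := by
  have : monicFinset F 0 = {1} := by
    ext h
    rw [mem_monicFinset, Finset.mem_singleton]
    exact ⟨fun h1 => h1.1.natDegree_eq_zero.mp h1.2, by rintro rfl; simp⟩
  rw [lCoeff, this, Finset.sum_singleton, resChar_one]

lemma pointSum_mul_lCoeff (χ ψ : MulChar F ℂ) (f : F[X]) {n j : ℕ} (hj : 0 < j) (hjn : j ≤ n) :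
    pointSum χ ψ f j * lCoeff χ ψ f (n - j) = ∑ h ∈ monicFinset F n,
      (((frobFixed F j).filter fun x => orbitPoly (frobClosure F) j x ∣
        h.map (algebraMap F (AlgebraicClosure F))).card : ℂ) * resChar χ ψ f h := by
  have h1 (h : F[X]) : (((frobFixed F j).filter fun x => orbitPoly (frobClosure F) j x ∣
        h.map (algebraMap F (AlgebraicClosure F))).card : ℂ) * resChar χ ψ f h =
      ∑ x ∈ frobFixed F j, if orbitPoly (frobClosure F) j x ∣
        h.map (algebraMap F (AlgebraicClosure F)) then resChar χ ψ f h else 0 := by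
    rw [← Finset.sum_filter, Finset.sum_const, nsmul_eq_mul]
  simp_rw [h1]
  rw [Finset.sum_comm, pointSum, Finset.sum_mul]
  refine Finset.sum_congr rfl fun x hx => ?_
  obtain ⟨h2, h3, h4⟩ := orbitPolyBase_spec hj hx
  rw [← Finset.sum_filter, lCoeff, Finset.mul_sum]
  refine Finset.sum_bij (fun h _ => orbitPolyBase F j x * h) (fun h hh => ?_)
    (fun a _ b _ hab => mul_left_cancel₀ h4.ne_zero hab) (fun h hh => ?_) fun h hh => ?_
  · rw [mem_monicFinset] at hh
    rw [Finset.mem_filter, mem_monicFinset, ← h2, map_dvd_map']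
    refine ⟨⟨h4.mul hh.1, ?_⟩, dvd_mul_right _ _⟩
    rw [h4.natDegree_mul hh.1, h3, hh.2]
    omega
  · rw [Finset.mem_filter, mem_monicFinset, ← h2, map_dvd_map'] at hh
    obtain ⟨⟨h5, h6⟩, g, rfl⟩ := hh
    have h7 : g.Monic := h4.of_mul_monic_left h5
    refine ⟨g, mem_monicFinset.mpr ⟨h7, ?_⟩, rfl⟩
    rw [h4.natDegree_mul h7, h3] at h6
    omega
  · rw [resChar_mul _ _ _ h4 (mem_monicFinset.mp hh).1]

/-- Newton's identities for the `L`-function. -/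
lemma natCast_mul_lCoeff (χ ψ : MulChar F ℂ) (f : F[X]) (n : ℕ) :
    (n : ℂ) * lCoeff χ ψ f n =
      ∑ j ∈ Finset.Icc 1 n, pointSum χ ψ f j * lCoeff χ ψ f (n - j) := by
  rw [Finset.sum_congr rfl fun j hj => pointSum_mul_lCoeff χ ψ f (Finset.mem_Icc.mp hj).1
    (Finset.mem_Icc.mp hj).2, Finset.sum_comm, lCoeff, Finset.mul_sum]
  refine Finset.sum_congr rfl fun h hh => ?_
  rw [mem_monicFinset] at hh
  rw [← Finset.sum_mul]
  congr 1
  have h1 := sum_card_orbitPoly_dvd (φ := frobClosure F)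
    (H := h.map (algebraMap F (AlgebraicClosure F))) ((hh.1.map _).ne_zero) (by
      rw [map_map]
      congr 1
      ext z
      simp) (frobFixed F) (fun j hj x => mem_frobFixed hj x)
  rw [natDegree_map, hh.2] at h1
  exact_mod_cast h1.symm

end LFunction

section TwoTerm

lemma le_of_forall_pow_le {x ρ C : ℝ} (hρ : 0 < ρ) {R : ℕ}
    (h : ∀ r, R ≤ r → x ^ r ≤ C * ρ ^ r) : x ≤ ρ := by
  by_contra! hx
  have h1 : 1 < x / ρ := (one_lt_div hρ).mpr hx
  obtain ⟨r, hr, hr'⟩ := ((tendsto_pow_atTop_atTop_of_one_lt h1).eventually_gt_atTop C).and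
    (Filter.eventually_ge_atTop R) |>.exists
  have h2 := h r hr'
  rw [← div_le_iff₀ (by positivity), ← div_pow] at h2
  linarith

lemma norm_le_of_norm_pow_add_pow_le {A B : ℂ} {ρ C : ℝ} (hρ : 0 < ρ) {R : ℕ}
    (h : ∀ r, R ≤ r → ‖A ^ r + B ^ r‖ ≤ C * ρ ^ r) : ‖A‖ ≤ ρ := by
  have hC : 0 ≤ C := by
    have h1 := (norm_nonneg _).trans (h R le_rfl)
    exact nonneg_of_mul_nonneg_left h1 (by positivity)
  refine le_of_forall_pow_le (C := 3 * C + 2) hρ (R := R) fun r hr => ?_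
  have h1 := h r hr
  have h2 := h (2 * r) (by omega)
  have h3 : ‖(A ^ r - B ^ r)‖ ^ 2 ≤ (C ^ 2 + 2 * C) * (ρ ^ r) ^ 2 := by
    rw [← norm_pow]
    have : (A ^ r - B ^ r) ^ 2 = 2 * (A ^ (2 * r) + B ^ (2 * r)) - (A ^ r + B ^ r) ^ 2 := by ring
    rw [this]
    refine (norm_sub_le _ _).trans ?_
    rw [norm_mul, norm_pow]
    have h4 : ‖A ^ r + B ^ r‖ ^ 2 ≤ (C * ρ ^ r) ^ 2 := by gcongr
    rw [show ρ ^ (2 * r) = (ρ ^ r) ^ 2 by ring] at h2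
    rw [Complex.norm_ofNat]
    nlinarith
  have h4 : ‖(A ^ r - B ^ r)‖ ≤ (C + 1) * ρ ^ r := by
    refine le_of_sq_le_sq ?_ (by positivity)
    rw [mul_pow]
    refine h3.trans ?_
    gcongr
    nlinarith
  have h5 : ‖2 * A ^ r‖ ≤ ‖A ^ r + B ^ r‖ + ‖A ^ r - B ^ r‖ := by
    rw [show 2 * A ^ r = (A ^ r + B ^ r) + (A ^ r - B ^ r) by ring]
    exact norm_add_le _ _
  rw [norm_mul, norm_pow, Complex.norm_ofNat] at h5
  have : 0 < ρ ^ r := by positivity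
  nlinarith

end TwoTerm

section LFunctionQuadratic

variable {F : Type*} [Field F] [Fintype F]

lemma lCoeff_eq_zero {χ : MulChar F ℂ} (hχ : χ ≠ 1) (ψ : MulChar F ℂ) {f : F[X]}
    (hf : f.natDegree = 2) (hf0 : f.coeff 0 ≠ 0) {n : ℕ} (hn : 3 ≤ n) :
    lCoeff χ ψ f n = 0 := by
  have hdeg (y : F) : (f * C y).natDegree ≤ 2 := (natDegree_mul_C_le f y).trans hf.le
  have hmem (h : F[X]) (hh : h ∈ monicFinset F n) (y : F) : h + f * C y ∈ monicFinset F n := by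
    rw [mem_monicFinset] at hh ⊢
    have h1 : (f * C y).degree < h.degree := by
      rw [degree_eq_natDegree hh.1.ne_zero, hh.2]
      refine (degree_le_of_natDegree_le (hdeg y)).trans_lt ?_
      exact_mod_cast hn
    exact ⟨hh.1.add_of_left h1, by rw [natDegree_add_eq_left_of_degree_lt h1, hh.2]⟩
  have hshift (y : F) : ∑ h ∈ monicFinset F n, resChar χ ψ f (h + f * C y) = lCoeff χ ψ f n := by
    refine Finset.sum_bij (fun h _ => h + f * C y) (fun h hh => hmem h hh y)
      (fun a _ b _ hab => add_right_cancel hab) (fun h hh => ?_) fun h hh => rfl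
    refine ⟨h + f * C (-y), hmem h hh (-y), ?_⟩
    rw [C_neg]
    ring
  have hres (h : F[X]) (hh : h ∈ monicFinset F n) (y : F) : resChar χ ψ f (h + f * C y) =
      χ ((-1) ^ n) * χ (h.coeff 0 + f.coeff 0 * y) * ψ (resultant h f) := by
    have h1 := (mem_monicFinset.mp hh).2
    have h2 := (mem_monicFinset.mp (hmem h hh y)).2
    have h3 : resultant (h + f * C y) f = resultant h f := by
      rw [h2, h1]
      exact resultant_add_mul_left h f (C y) n f.natDegree (by rw [natDegree_C]; omega) le_rfl
    have h4 : resultant (h + f * C y) X = (-1) ^ n * (h.coeff 0 + f.coeff 0 * y) := by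
      have := resultant_X_sub_C_right (h + f * C y) n 0 h2.le
      rw [C_0, sub_zero] at this
      rw [natDegree_X, h2, this]
      simp [coeff_zero_eq_eval_zero]
    rw [resChar, h3, h4, map_mul]
  have hq : (Fintype.card F : ℂ) * lCoeff χ ψ f n = 0 := by
    calc (Fintype.card F : ℂ) * lCoeff χ ψ f n
        = ∑ y : F, ∑ h ∈ monicFinset F n, resChar χ ψ f (h + f * C y) := by
          rw [Finset.sum_congr rfl fun y _ => hshift y]
          simp
      _ = ∑ h ∈ monicFinset F n, ∑ y : F, resChar χ ψ f (h + f * C y) := Finset.sum_comm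
      _ = 0 := by
          refine Finset.sum_eq_zero fun h hh => ?_
          rw [Finset.sum_congr rfl fun y _ => hres h hh y, ← Finset.sum_mul, ← Finset.mul_sum]
          have h5 : ∑ y : F, χ (h.coeff 0 + f.coeff 0 * y) = ∑ z : F, χ z :=
            Function.Bijective.sum_comp (e := fun y => h.coeff 0 + f.coeff 0 * y)
              ((Equiv.mulLeft₀ _ hf0).trans (Equiv.addLeft (h.coeff 0))).bijective χ
          rw [h5, MulChar.sum_eq_zero_of_ne_one hχ, mul_zero, zero_mul]
  refine (mul_eq_zero.mp hq).resolve_left ?_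
  exact_mod_cast Fintype.card_ne_zero

lemma exists_pointSum_eq {χ : MulChar F ℂ} (hχ : χ ≠ 1) (ψ : MulChar F ℂ) {f : F[X]}
    (hf : f.natDegree = 2) (hf0 : f.coeff 0 ≠ 0) :
    ∃ A B : ℂ, ∀ n, 1 ≤ n → pointSum χ ψ f n = -(A ^ n + B ^ n) := by
  set a₁ := lCoeff χ ψ f 1 with ha₁
  set a₂ := lCoeff χ ψ f 2 with ha₂
  obtain ⟨s, hs⟩ := IsAlgClosed.exists_pow_nat_eq (a₁ ^ 2 - 4 * a₂) (n := 2) (by norm_num)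
  refine ⟨(-a₁ + s) / 2, (-a₁ - s) / 2, fun n hn => ?_⟩
  have hsum : (-a₁ + s) / 2 + (-a₁ - s) / 2 = -a₁ := by ring
  have hprod : (-a₁ + s) / 2 * ((-a₁ - s) / 2) = a₂ := by linear_combination -hs / 4
  set A := (-a₁ + s) / 2
  set B := (-a₁ - s) / 2
  have h1 : pointSum χ ψ f 1 = a₁ := by
    have := natCast_mul_lCoeff χ ψ f 1
    simpa [lCoeff_zero] using this.symm
  have h2 : pointSum χ ψ f 2 = 2 * a₂ - a₁ ^ 2 := by
    have := natCast_mul_lCoeff χ ψ f 2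
    rw [show Finset.Icc 1 2 = {1, 2} by decide, Finset.sum_pair (by norm_num)] at this
    simp only [Nat.add_one_sub_one, Nat.reduceSub, lCoeff_zero, h1] at this
    push_cast at this
    rw [← ha₁, ← ha₂] at this
    linear_combination -this
  have h3 (n : ℕ) : pointSum χ ψ f (n + 3) =
      -(pointSum χ ψ f (n + 2) * a₁ + pointSum χ ψ f (n + 1) * a₂) := by
    have := natCast_mul_lCoeff χ ψ f (n + 3)
    rw [lCoeff_eq_zero hχ ψ hf hf0 (by omega), mul_zero] at this
    have hsub : ({n + 1, n + 2, n + 3} : Finset ℕ) ⊆ Finset.Icc 1 (n + 3) := by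
      intro x hx
      simp only [Finset.mem_insert, Finset.mem_singleton] at hx
      rw [Finset.mem_Icc]
      omega
    rw [← Finset.sum_subset hsub] at this
    · rw [Finset.sum_insert (by simp), Finset.sum_pair (by simp),
        show n + 3 - (n + 1) = 2 by omega, show n + 3 - (n + 2) = 1 by omega, Nat.sub_self,
        lCoeff_zero] at this
      rw [← ha₁, ← ha₂] at this
      linear_combination -this
    · intro x hx hx'
      simp only [Finset.mem_insert, Finset.mem_singleton, Finset.mem_Icc] at hx hx'
      rw [lCoeff_eq_zero hχ ψ hf hf0 (by omega), mul_zero]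
  have ha₁' : a₁ = -(A + B) := by linear_combination -hsum
  induction n using Nat.strong_induction_on with
  | _ n ih =>
    match n, hn with
    | 1, _ => rw [h1, ha₁']; ring
    | 2, _ => rw [h2, ha₁', ← hprod]; ring
    | n + 3, _ =>
      rw [h3, ih (n + 2) (by omega) (by omega), ih (n + 1) (by omega) (by omega), ha₁', ← hprod]
      ring

end LFunctionQuadratic

section QuadraticBound

variable {F : Type*} [Field F] [Fintype F]

lemma exists_extension_card (n : ℕ) (hn : n ≠ 0) :
    ∃ (K : Type) (_ : Field K) (_ : Fintype K) (_ : Algebra F K),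
      Fintype.card K = Fintype.card F ^ n := by
  obtain ⟨p, hp⟩ := CharP.exists F
  have : Fact p.Prime := ⟨CharP.char_is_prime F p⟩
  have : NeZero n := ⟨hn⟩
  let _ : Fintype (FiniteField.Extension F p n) :=
    @Fintype.ofFinite _ (Module.finite_of_finite F)
  refine ⟨FiniteField.Extension F p n, inferInstance, inferInstance, inferInstance, ?_⟩
  have := FiniteField.natCard_extension F p n
  rwa [Nat.card_eq_fintype_card, Nat.card_eq_fintype_card] at this

lemma rootMultiplicity_quadratic_eq_one {L : Type*} [Field L] {a b c α : L} (ha : a ≠ 0)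
    (hdisc : b ^ 2 - 4 * a * c ≠ 0) (hα : (C a * X ^ 2 + C b * X + C c).IsRoot α) :
    (C a * X ^ 2 + C b * X + C c).rootMultiplicity α = 1 := by
  have h0 : (C a * X ^ 2 + C b * X + C c) ≠ 0 := by
    intro h
    have := natDegree_quadratic (b := b) (c := c) ha
    rw [h, natDegree_zero] at this
    omega
  refine le_antisymm ?_ ((rootMultiplicity_pos h0).mpr hα)
  by_contra! h
  have h1 := ((one_lt_rootMultiplicity_iff_isRoot h0).mp h).2
  apply hdisc
  simp only [IsRoot.def, eval_add, eval_mul, eval_C, eval_pow, eval_X] at hα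
  simp [IsRoot.def] at h1
  linear_combination (2 * a * α + b) * h1 - 4 * a * hα

lemma norm_sum_quadratic_le_of_ne_one {χ : MulChar F ℂ} (hχ : χ ≠ 1) (ψ : MulChar F ℂ) {a b c : F}
    (ha : a ≠ 0) (hc : c ≠ 0) (hdisc : b ^ 2 - 4 * a * c ≠ 0) :
    ‖∑ x, χ x * ψ (a * x ^ 2 + b * x + c)‖ ≤ 2 * √(Fintype.card F) := by
  set f : F[X] := C a * X ^ 2 + C b * X + C c with hf
  have hfdeg : f.natDegree = 2 := natDegree_quadratic ha
  have hf0 : f.coeff 0 = c := by simp [hf]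
  set ι := algebraMap F (AlgebraicClosure F)
  have hmap : f.map ι = C (ι a) * X ^ 2 + C (ι b) * X + C (ι c) := by simp [hf]
  have hιa : ι a ≠ 0 := by simpa using ha
  obtain ⟨α, hα⟩ := IsAlgClosed.exists_root (f.map ι) (by
    rw [hmap, degree_quadratic hιa]; norm_num)
  have hα0 : α ≠ 0 := by
    rintro rfl
    rw [IsRoot.def, hmap] at hα
    simp at hα
    exact hc hα
  have hmult : (f.map ι).rootMultiplicity α = 1 := by
    rw [hmap] at hα ⊢
    refine rootMultiplicity_quadratic_eq_one hιa ?_ hα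
    have : ι (b ^ 2 - 4 * a * c) ≠ 0 := by simpa only [ne_eq, map_eq_zero] using hdisc
    simpa only [map_sub, map_mul, map_pow, map_ofNat] using this
  obtain ⟨A, B, hAB⟩ := exists_pointSum_eq hχ ψ hfdeg (hf0.symm ▸ hc)
  have hq : 2 ≤ Fintype.card F := Fintype.one_lt_card
  have hbound (r : ℕ) (hr : 2 * Fintype.card F ^ 2 + 10 ≤ r) :
      ‖pointSum χ ψ f (2 * r)‖ ≤
        (13 * (Fintype.card F : ℝ) ^ 2 + 3) * (Fintype.card F : ℝ) ^ r := by
    obtain ⟨K, _, _, _, hK⟩ := exists_extension_card (F := F) (2 * r) (by omega)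
    rw [← sum_norm_eq_pointSum (by omega) hK]
    have h1 : 2 * (Fintype.card F - 1) ^ 2 + 10 ≤ Fintype.card F ^ r := by
      have h2 : (Fintype.card F - 1) ^ 2 ≤ Fintype.card F ^ 2 :=
        Nat.pow_le_pow_left (Nat.sub_le _ _) 2
      have h3 : r < Fintype.card F ^ r := Nat.lt_pow_self hq
      omega
    have := norm_sum_norm_le_of_stepanov (F := F) (K := K) (r := r) rfl
      (by rw [hK, mul_comm, pow_mul]) h1 hfdeg.le hα0 hmult χ ψ (Or.inl hχ)
    simpa using this
  have hle {A B : ℂ} (hAB : ∀ n, 1 ≤ n → pointSum χ ψ f n = -(A ^ n + B ^ n)) :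
      ‖A‖ ≤ √(Fintype.card F) := by
    refine Real.le_sqrt_of_sq_le ?_
    rw [← norm_pow]
    refine norm_le_of_norm_pow_add_pow_le (B := B ^ 2)
      (C := 13 * (Fintype.card F : ℝ) ^ 2 + 3) (by positivity)
      (R := 2 * Fintype.card F ^ 2 + 10) fun r hr => ?_
    rw [← pow_mul, ← pow_mul, ← norm_neg, ← hAB _ (by omega)]
    exact hbound r hr
  have hA := hle hAB
  have hB := hle (A := B) (B := A) fun n hn => by rw [hAB n hn, add_comm]
  have h1 := sum_norm_eq_pointSum (F := F) (K := F) (j := 1) one_pos (pow_one _).symm χ ψ f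
  have h2 : ∑ x, χ x * ψ (a * x ^ 2 + b * x + c) = -(A + B) := by
    rw [← pow_one A, ← pow_one B, ← hAB 1 le_rfl, ← h1]
    refine Finset.sum_congr rfl fun x _ => ?_
    rw [Algebra.norm_self, MonoidHom.id_apply, MonoidHom.id_apply]
    simp [hf]
  rw [h2, norm_neg]
  linarith [norm_add_le A B]

end QuadraticBound

section QuadraticBound

variable {F : Type*} [Field F] [Fintype F]

lemma one_le_sqrt_card : 1 ≤ √(Fintype.card F : ℝ) := by
  rw [Real.one_le_sqrt]
  exact_mod_cast Fintype.card_pos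

lemma norm_jacobiSum_le {χ ψ : MulChar F ℂ} (h : χ ≠ 1 ∨ ψ ≠ 1) :
    ‖jacobiSum χ ψ‖ ≤ √(Fintype.card F) := by
  have h1 := one_le_sqrt_card (F := F)
  by_cases hχ : χ = 1
  · subst hχ
    rw [jacobiSum_one_nontrivial (h.resolve_left (by simp))]
    simpa using h1
  by_cases hψ : ψ = 1
  · subst hψ
    rw [jacobiSum_comm, jacobiSum_one_nontrivial hχ]
    simpa using h1
  by_cases hχψ : χ * ψ = 1
  · rw [eq_inv_of_mul_eq_one_right hχψ, jacobiSum_nontrivial_inv hχ, norm_neg]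
    exact (norm_mulChar_le_one _ _).trans h1
  have h2 := jacobiSum_mul_jacobiSum_inv (F' := ℂ) (by
    rw [ringChar.eq_zero]
    exact (CharP.ringChar_ne_zero_of_finite F).symm) hχ hψ hχψ
  have h3 : jacobiSum χ⁻¹ ψ⁻¹ = star (jacobiSum χ ψ) := by
    simp only [jacobiSum, star_sum, star_mul', MulChar.star_apply']
  refine Real.le_sqrt_of_sq_le (le_of_eq ?_)
  rw [h3] at h2
  have h4 := congrArg norm h2
  rw [norm_mul, norm_star] at h4
  simpa [sq] using h4

/-- The mixed character sum attached to a quadratic polynomial. -/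
noncomputable def quadSum (χ ψ : MulChar F ℂ) (a b c : F) : ℂ :=
  ∑ x, χ x * ψ (a * x ^ 2 + b * x + c)

lemma quadSum_zero {χ ψ : MulChar F ℂ} {a b : F} (ha : a ≠ 0) (hb : b ≠ 0) :
    quadSum χ ψ a b 0 = (χ * ψ) (-(b / a)) * ψ b * jacobiSum (χ * ψ) ψ := by
  have hbij : -(b / a) ≠ 0 := by simp [ha, hb]
  rw [quadSum, ← Equiv.sum_comp (Equiv.mulLeft₀ _ hbij), jacobiSum, Finset.mul_sum]
  refine Finset.sum_congr rfl fun u _ => ?_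
  change χ (-(b / a) * u) * ψ (a * (-(b / a) * u) ^ 2 + b * (-(b / a) * u) + 0) = _
  have : a * (-(b / a) * u) ^ 2 + b * (-(b / a) * u) + 0 = (-(b / a) * u) * (b * (1 - u)) := by
    field_simp
    ring
  rw [this]
  simp only [map_mul, MulChar.mul_apply]
  ring

lemma quadSum_one_left (ψ : MulChar F ℂ) (a b c : F) :
    quadSum 1 ψ a b c = quadSum (ψ⁻¹ ^ 2) ψ c b a := by
  rw [quadSum, ← Equiv.sum_comp (Function.Involutive.toPerm _ (inv_involutive (G := F))), quadSum]
  refine Finset.sum_congr rfl fun x _ => ?_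
  rw [Function.Involutive.coe_toPerm]
  by_cases hx : x = 0
  · simp [hx, MulChar.map_zero]
  rw [MulChar.one_apply (isUnit_iff_ne_zero.mpr (inv_ne_zero hx)), one_mul,
    MulChar.pow_apply' _ two_ne_zero, MulChar.inv_apply', ← map_pow, ← map_mul]
  congr 1
  field_simp
  ring

lemma eq_one_of_sq_eq_one {ψ : MulChar F ℂ} (hF : ringChar F = 2) (h : ψ ^ 2 = 1) : ψ = 1 := by
  ext y
  obtain ⟨z, hz⟩ := FiniteField.isSquare_of_char_two hF (y : F)
  have hz0 : z ≠ 0 := by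
    rintro rfl
    simp at hz
  rw [hz, MulChar.one_apply (by simpa using hz0), map_mul, ← sq, ← MulChar.pow_apply' _ two_ne_zero,
    h, MulChar.one_apply (isUnit_iff_ne_zero.mpr hz0)]

lemma norm_sum_sq_sub_le (hF : ringChar F ≠ 2) {ψ : MulChar F ℂ} (hψ : ψ ≠ 1) {δ : F}
    (hδ : δ ≠ 0) : ‖∑ x, ψ (x ^ 2 - δ)‖ ≤ √(Fintype.card F) := by
  set η : MulChar F ℂ := (quadraticChar F).ringHomComp (Int.castRingHom ℂ) with hη
  have h1 : ∑ x, ψ (x ^ 2 - δ) = ∑ u, (η u + 1) * ψ (u - δ) := by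
    rw [← Finset.sum_fiberwise (s := Finset.univ) (g := fun x : F => x ^ 2)]
    refine Finset.sum_congr rfl fun u _ => ?_
    have h2 := congrArg (Int.cast : ℤ → ℂ) (quadraticChar_card_sqrts hF u)
    rw [Finset.sum_congr rfl (g := fun _ => ψ (u - δ)) fun x hx => by
      rw [(Finset.mem_filter.mp hx).2], Finset.sum_const, nsmul_eq_mul]
    congr 1
    rw [hη, MulChar.ringHomComp_apply, eq_intCast]
    push_cast at h2
    rw [← h2]
    congr 2
    ext x
    simp
  have h2 : ∑ u, ψ (u - δ) = 0 := by
    rw [← MulChar.sum_eq_zero_of_ne_one hψ]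
    exact (Equiv.subRight δ).sum_comp ψ
  have h3 : ∑ u, η u * ψ (u - δ) = η δ * ψ (-δ) * jacobiSum η ψ := by
    rw [← Equiv.sum_comp (Equiv.mulLeft₀ _ hδ), jacobiSum, Finset.mul_sum]
    refine Finset.sum_congr rfl fun u _ => ?_
    change η (δ * u) * ψ (δ * u - δ) = _
    rw [show δ * u - δ = -δ * (1 - u) by ring, map_mul, map_mul]
    ring
  simp only [h1, add_mul, one_mul, Finset.sum_add_distrib, h2, h3, add_zero, norm_mul]
  have h4 := norm_mulChar_le_one η δ
  have h5 := norm_mulChar_le_one ψ (-δ)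
  have h6 := norm_jacobiSum_le (χ := η) (Or.inr hψ)
  have h7 : ‖η δ‖ * ‖ψ (-δ)‖ ≤ 1 := mul_le_one₀ h4 (norm_nonneg _) h5
  exact (mul_le_of_le_one_left (norm_nonneg _) h7).trans h6

lemma norm_quadSum_le {χ ψ : MulChar F ℂ} (h : χ ≠ 1 ∨ ψ ≠ 1) {a b c : F}
    (ha : a ≠ 0) (hdisc : b ^ 2 - 4 * a * c ≠ 0) :
    ‖quadSum χ ψ a b c‖ ≤ 2 * √(Fintype.card F) := by
  have hq := one_le_sqrt_card (F := F)
  by_cases hc : c = 0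
  · subst hc
    have hb : b ≠ 0 := by
      rintro rfl
      simp at hdisc
    have h1 : χ * ψ ≠ 1 ∨ ψ ≠ 1 := by
      by_contra! h1
      obtain ⟨h1, rfl⟩ := h1
      rw [mul_one] at h1
      exact h.elim (· h1) (· rfl)
    rw [quadSum_zero ha hb, norm_mul, norm_mul]
    have h4 := norm_mulChar_le_one (χ * ψ) (-(b / a))
    have h5 := norm_mulChar_le_one ψ b
    have h7 := mul_le_one₀ h4 (norm_nonneg _) h5
    linarith [mul_le_of_le_one_left (norm_nonneg (jacobiSum (χ * ψ) ψ)) h7, norm_jacobiSum_le h1]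
  by_cases hχ : χ ≠ 1
  · exact norm_sum_quadratic_le_of_ne_one hχ ψ ha hc hdisc
  push Not at hχ
  subst hχ
  have hψ : ψ ≠ 1 := h.resolve_left (by simp)
  by_cases hψ2 : ψ⁻¹ ^ 2 ≠ 1
  · rw [quadSum_one_left]
    exact norm_sum_quadratic_le_of_ne_one hψ2 ψ hc ha (by convert hdisc using 1; ring)
  push Not at hψ2
  have hψ2' : ψ ^ 2 = 1 := by simpa using hψ2
  have hF : ringChar F ≠ 2 := fun hF => hψ (eq_one_of_sq_eq_one hF hψ2')
  have h2 : (2 : F) ≠ 0 := Ring.two_ne_zero hF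
  have h1 : quadSum 1 ψ a b c = ψ a * ∑ x, ψ (x ^ 2 - (b ^ 2 - 4 * a * c) / (2 * a) ^ 2) - ψ c := by
    rw [eq_sub_iff_add_eq, ← Equiv.sum_comp (Equiv.addRight (b / (2 * a))), quadSum, Finset.mul_sum]
    have h3 (x : F) : ψ a * ψ ((Equiv.addRight (b / (2 * a)) x) ^ 2 -
        (b ^ 2 - 4 * a * c) / (2 * a) ^ 2) = ψ (a * x ^ 2 + b * x + c) := by
      rw [← map_mul, Equiv.coe_addRight]
      congr 1
      field_simp
      ring
    simp_rw [h3]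
    rw [← Finset.add_sum_erase _ _ (Finset.mem_univ (0 : F)),
      ← Finset.add_sum_erase _ (fun x => ψ (a * x ^ 2 + b * x + c)) (Finset.mem_univ (0 : F))]
    rw [Finset.sum_congr rfl (g := fun x => ψ (a * x ^ 2 + b * x + c)) fun x hx => by
      rw [MulChar.one_apply (isUnit_iff_ne_zero.mpr (Finset.ne_of_mem_erase hx)), one_mul]]
    simp [MulChar.map_zero, add_comm]
  rw [h1]
  refine (norm_sub_le _ _).trans ?_
  rw [norm_mul]
  have h4 := norm_mulChar_le_one ψ a
  have h5 := norm_mulChar_le_one ψ c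
  have h6 := norm_sum_sq_sub_le hF hψ (δ := (b ^ 2 - 4 * a * c) / (2 * a) ^ 2)
    (div_ne_zero hdisc (pow_ne_zero 2 (mul_ne_zero h2 ha)))
  linarith [mul_le_of_le_one_left
    (norm_nonneg (∑ x, ψ (x ^ 2 - (b ^ 2 - 4 * a * c) / (2 * a) ^ 2))) h4]

end QuadraticBound

section Indicators

variable {F : Type*} [Field F] [Fintype F]

noncomputable instance : Fintype (MulChar F ℂ) := Fintype.ofFinite _

/-- The complex characters of `F` whose `k`-th power is trivial. -/
noncomputable def powChars (F : Type*) [Field F] [Fintype F] (k : ℕ) : Finset (MulChar F ℂ) :=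
  {ψ | ψ ^ k = 1}

lemma mem_powChars {k : ℕ} {ψ : MulChar F ℂ} : ψ ∈ powChars F k ↔ ψ ^ k = 1 := by
  simp [powChars]

lemma natCard_units_eq : Nat.card Fˣ = Fintype.card F - 1 := by
  rw [Nat.card_eq_fintype_card, Fintype.card_units]

lemma card_powChars {k : ℕ} (hk : k ∣ Fintype.card F - 1) : (powChars F k).card = k := by
  obtain ⟨e⟩ := MulChar.mulEquiv_units F ℂ
  have h1 := IsCyclic.card_powMonoidHom_ker (G := Fˣ) k
  rw [natCard_units_eq, Nat.gcd_eq_right hk] at h1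
  change Nat.card ((powMonoidHom k : Fˣ →* Fˣ).ker : Set Fˣ) = k at h1
  rw [Nat.card_eq_card_toFinset] at h1
  refine Eq.trans ?_ h1
  refine Finset.card_bij (fun ψ _ => e ψ) (fun ψ hψ => ?_) (fun _ _ _ _ h => e.injective h)
    fun u hu => ?_
  · rw [mem_powChars] at hψ
    simp [MonoidHom.mem_ker, ← map_pow, hψ]
  · simp only [Set.mem_toFinset, SetLike.mem_coe, MonoidHom.mem_ker, powMonoidHom_apply] at hu
    refine ⟨e.symm u, ?_, e.apply_symm_apply u⟩
    rw [mem_powChars, ← map_pow, hu, map_one]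

lemma exists_pow_eq_of_pow_eq_one {k m : ℕ} (hkm : k * m = Fintype.card F - 1) {y : F}
    (hy : y ^ m = 1) : ∃ z, z ^ k = y := by
  have hq : 0 < Fintype.card F - 1 := Nat.sub_pos_of_lt Fintype.one_lt_card
  have hm : m ≠ 0 := by
    rintro rfl
    omega
  have hk : 0 < k := Nat.pos_of_ne_zero (by rintro rfl; omega)
  let u : Fˣ := Units.ofPowEqOne y m hy hm
  have hle : (powMonoidHom k : Fˣ →* Fˣ).range ≤ (powMonoidHom m : Fˣ →* Fˣ).ker := by
    rintro _ ⟨v, rfl⟩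
    rw [MonoidHom.mem_ker, powMonoidHom_apply, powMonoidHom_apply, ← pow_mul, hkm,
      ← natCard_units_eq, pow_card_eq_one']
  have heq := Subgroup.eq_of_le_of_card_ge hle (by
    rw [IsCyclic.card_powMonoidHom_ker, IsCyclic.card_powMonoidHom_range, natCard_units_eq, ← hkm,
      Nat.gcd_mul_left_left, Nat.gcd_mul_right_left, Nat.mul_div_cancel_left _ hk])
  have hu : u ∈ (powMonoidHom m : Fˣ →* Fˣ).ker := by
    rw [MonoidHom.mem_ker, powMonoidHom_apply]
    exact Units.pow_ofPowEqOne hy hm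
  rw [← heq] at hu
  obtain ⟨v, hv⟩ := hu
  refine ⟨v, ?_⟩
  have := congrArg Units.val hv
  simpa [u] using this

lemma sum_powChars {k : ℕ} (hk : k ∣ Fintype.card F - 1) {y : F} (hy : y ≠ 0) :
    ∑ ψ ∈ powChars F k, ψ y = if ∃ z, z ^ k = y then (k : ℂ) else 0 := by
  have hq : 0 < Fintype.card F - 1 := Nat.sub_pos_of_lt Fintype.one_lt_card
  have hk0 : k ≠ 0 := by
    rintro rfl
    rw [zero_dvd_iff] at hk
    omega
  split_ifs with h
  · obtain ⟨z, rfl⟩ := h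
    have hz : z ≠ 0 := by
      rintro rfl
      exact hy (zero_pow hk0)
    rw [Finset.sum_congr rfl (g := fun _ => 1) fun ψ hψ => ?_, Finset.sum_const, card_powChars hk,
      nsmul_eq_mul, mul_one]
    rw [map_pow, ← MulChar.pow_apply' _ hk0, mem_powChars.mp hψ,
      MulChar.one_apply (isUnit_iff_ne_zero.mpr hz)]
  · obtain ⟨m, hm⟩ := hk
    have hm0 : m ≠ 0 := by
      rintro rfl
      omega
    have h1 : y ^ m ≠ 1 := fun h1 => h (exists_pow_eq_of_pow_eq_one hm.symm h1)
    obtain ⟨χ, hχ⟩ := MulChar.exists_apply_ne_one_of_hasEnoughRootsOfUnity F ℂ h1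
    rw [map_pow, ← MulChar.pow_apply' _ hm0] at hχ
    have hχk : (χ ^ m) ^ k = 1 := by
      rw [← pow_mul, mul_comm, ← hm, ← natCard_units_eq, Nat.card_eq_fintype_card]
      exact MulChar.pow_card_eq_one χ
    have h2 : ∑ ψ ∈ powChars F k, ψ y = (χ ^ m) y * ∑ ψ ∈ powChars F k, ψ y := by
      rw [Finset.mul_sum]
      refine Finset.sum_bij (fun ψ _ => (χ ^ m)⁻¹ * ψ) (fun ψ hψ => ?_)
        (fun _ _ _ _ h => mul_left_cancel h) (fun ψ hψ => ⟨χ ^ m * ψ, ?_, by simp⟩) fun ψ hψ => ?_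
      · rw [mem_powChars] at hψ ⊢
        rw [mul_pow, inv_pow, hχk, hψ, inv_one, one_mul]
      · rw [mem_powChars] at hψ ⊢
        rw [mul_pow, hχk, hψ, one_mul]
      · rw [← MulChar.mul_apply, mul_inv_cancel_left]
    by_contra h3
    exact hχ (mul_right_cancel₀ h3 (by rw [one_mul, ← h2]))

lemma exists_coeff_of_primes (s : Finset ℕ) (hs : ∀ ℓ ∈ s, ℓ.Prime ∧ ℓ ∣ Fintype.card F - 1) :
    ∃ c : MulChar F ℂ → ℂ,
      (∀ x ≠ 0, ∑ χ, c χ * χ x = if ∀ ℓ ∈ s, ¬ ∃ z, z ^ ℓ = x then 1 else 0) ∧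
      c 1 = ∏ ℓ ∈ s, (1 - (ℓ : ℂ)⁻¹) ∧
      ∑ χ, ‖c χ‖ ≤ 2 ^ s.card * ∏ ℓ ∈ s, (1 - (ℓ : ℝ)⁻¹) ∧
      ∀ χ, c χ ≠ 0 → χ ^ (∏ ℓ ∈ s, ℓ) = 1 := by
  induction s using Finset.induction_on with
  | empty =>
    refine ⟨fun χ => if χ = 1 then 1 else 0, fun x hx => ?_, by simp, ?_, by simp⟩
    · simp [MulChar.one_apply (isUnit_iff_ne_zero.mpr hx)]
    · simp [apply_ite norm]
  | insert ℓ s hℓs ih =>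
    obtain ⟨c, hc1, hc2, hc3, hc4⟩ := ih fun p hp => hs p (Finset.mem_insert_of_mem hp)
    obtain ⟨hℓ, hℓq⟩ := hs ℓ (Finset.mem_insert_self _ _)
    have hℓ0 : (ℓ : ℂ) ≠ 0 := by exact_mod_cast hℓ.ne_zero
    have h1mem : (1 : MulChar F ℂ) ∈ powChars F ℓ := mem_powChars.mpr (one_pow _)
    let e : MulChar F ℂ → ℂ := fun η => (if η = 1 then 1 else 0) - (ℓ : ℂ)⁻¹
    refine ⟨fun χ => ∑ η ∈ powChars F ℓ, e η * c (χ * η⁻¹), fun x hx => ?_, ?_, ?_, fun χ hχ => ?_⟩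
    · have h1 : ∑ χ, (∑ η ∈ powChars F ℓ, e η * c (χ * η⁻¹)) * χ x =
          (∑ η ∈ powChars F ℓ, e η * η x) * ∑ χ, c χ * χ x := by
        simp_rw [Finset.sum_mul]
        rw [Finset.sum_comm]
        refine Finset.sum_congr rfl fun η _ => ?_
        rw [Finset.mul_sum, ← Equiv.sum_comp (Equiv.mulRight η)]
        refine Finset.sum_congr rfl fun χ _ => ?_
        rw [Equiv.coe_mulRight, mul_inv_cancel_right, MulChar.mul_apply]
        ring
      have h2 : ∑ η ∈ powChars F ℓ, e η * η x = if ∃ z, z ^ ℓ = x then 0 else 1 := by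
        simp only [e, sub_mul, Finset.sum_sub_distrib, ← Finset.mul_sum, ite_mul, one_mul,
          zero_mul]
        rw [sum_powChars hℓq hx, Finset.sum_ite_eq' , if_pos h1mem,
          MulChar.one_apply (isUnit_iff_ne_zero.mpr hx)]
        split_ifs
        · rw [inv_mul_cancel₀ hℓ0, sub_self]
        · rw [mul_zero, sub_zero]
      rw [h1, h2, hc1 x hx]
      simp only [Finset.forall_mem_insert]
      by_cases hz : ∃ z, z ^ ℓ = x
      · simp [hz]
      · simp [hz]
    · beta_reduce
      rw [Finset.sum_eq_single_of_mem 1 h1mem, Finset.prod_insert hℓs]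
      · simp [e, hc2]
      · intro η hη hη1
        have h3 : c (1 * η⁻¹) = 0 := by
          by_contra h3
          have h4 := hc4 _ h3
          rw [one_mul, inv_pow, inv_eq_one] at h4
          have hcop : Nat.Coprime ℓ (∏ p ∈ s, p) := Nat.Coprime.prod_right fun p hp =>
            (Nat.coprime_primes hℓ (hs p (Finset.mem_insert_of_mem hp)).1).mpr (by
              rintro rfl
              exact hℓs hp)
          apply hη1
          rw [← orderOf_eq_one_iff, ← Nat.dvd_one, ← hcop]
          exact Nat.dvd_gcd (orderOf_dvd_of_pow_eq_one (mem_powChars.mp hη))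
            (orderOf_dvd_of_pow_eq_one h4)
        rw [h3, mul_zero]
    · have h5 : ∑ η ∈ powChars F ℓ, ‖e η‖ = 2 * (1 - (ℓ : ℝ)⁻¹) := by
        have hℓ1 : (ℓ : ℝ)⁻¹ ≤ 1 := Nat.cast_inv_le_one ℓ
        rw [← Finset.add_sum_erase _ _ h1mem, Finset.sum_congr rfl (g := fun _ => (ℓ : ℝ)⁻¹)
          fun η hη => by simp [e, Finset.ne_of_mem_erase hη], Finset.sum_const,
          Finset.card_erase_of_mem h1mem, card_powChars hℓq, nsmul_eq_mul,
          Nat.cast_sub hℓ.one_le]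
        have h6 : ‖e 1‖ = 1 - (ℓ : ℝ)⁻¹ := by
          have : e 1 = ((1 - (ℓ : ℝ)⁻¹ : ℝ) : ℂ) := by simp [e]
          rw [this, Complex.norm_real, Real.norm_of_nonneg (by linarith)]
        have : (ℓ : ℝ) ≠ 0 := by exact_mod_cast hℓ.ne_zero
        rw [h6]
        field_simp
        push_cast
        ring
      calc ∑ χ, ‖∑ η ∈ powChars F ℓ, e η * c (χ * η⁻¹)‖
          ≤ ∑ χ, ∑ η ∈ powChars F ℓ, ‖e η‖ * ‖c (χ * η⁻¹)‖ := by
            gcongr with χ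
            refine (norm_sum_le _ _).trans (le_of_eq ?_)
            simp_rw [norm_mul]
        _ = (∑ η ∈ powChars F ℓ, ‖e η‖) * ∑ χ, ‖c χ‖ := by
            rw [Finset.sum_comm, Finset.sum_mul]
            refine Finset.sum_congr rfl fun η _ => ?_
            rw [← Finset.mul_sum]
            congr 1
            exact Equiv.sum_comp (Equiv.mulRight η⁻¹) fun χ => ‖c χ‖
        _ ≤ (∑ η ∈ powChars F ℓ, ‖e η‖) * (2 ^ s.card * ∏ ℓ ∈ s, (1 - (ℓ : ℝ)⁻¹)) := by
            gcongr
        _ = _ := by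
            rw [h5, Finset.card_insert_of_notMem hℓs, Finset.prod_insert hℓs]
            ring
    · obtain ⟨η, hη, h7⟩ := Finset.exists_ne_zero_of_sum_ne_zero hχ
      have h8 := hc4 _ (right_ne_zero_of_mul h7)
      rw [mem_powChars] at hη
      rw [Finset.prod_insert hℓs]
      calc χ ^ (ℓ * ∏ p ∈ s, p) = ((χ * η⁻¹) ^ ∏ p ∈ s, p) ^ ℓ * (η ^ ℓ) ^ ∏ p ∈ s, p := by
            rw [← pow_mul, ← pow_mul, mul_comm (∏ p ∈ s, p), ← mul_pow, inv_mul_cancel_right]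
        _ = 1 := by rw [h8, hη, one_pow, one_pow, one_mul]

end Indicators

section Counting

variable {F : Type*} [Field F]

lemma isTFree_iff {t : ℕ} (ht : t ≠ 0) {x : F} (hx : x ≠ 0) :
    IsTFree t x ↔ ∀ ℓ ∈ t.primeFactors, ¬ ∃ z, z ^ ℓ = x := by
  constructor
  · intro h ℓ hℓ hz
    have hp := Nat.prime_of_mem_primeFactors hℓ
    exact hp.ne_one (h.2 ℓ hp.pos (Nat.dvd_of_mem_primeFactors hℓ) hz)
  · refine fun h => ⟨hx, fun d _ hdt => ?_⟩
    rintro ⟨y, rfl⟩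
    by_contra hd
    have hp := Nat.minFac_prime hd
    refine h d.minFac (Nat.mem_primeFactors.mpr ⟨hp, d.minFac_dvd.trans hdt, ht⟩)
      ⟨y ^ (d / d.minFac), ?_⟩
    rw [← pow_mul, Nat.div_mul_cancel d.minFac_dvd]

lemma Wnum_eq {t : ℕ} (ht : t ≠ 0) : Wnum t = 2 ^ t.primeFactors.card := by
  have h := Nat.sum_divisors_filter_squarefree ht (f := fun _ => 1)
  rw [Finset.sum_const, Finset.sum_const, smul_eq_mul, smul_eq_mul, mul_one, mul_one,
    Finset.card_powerset] at h
  rw [Wnum, h]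
  congr 2
  rw [Nat.factors_eq]
  rfl

lemma prod_one_sub_inv {t : ℕ} (ht : t ≠ 0) :
    ∏ ℓ ∈ t.primeFactors, (1 - (ℓ : ℝ)⁻¹) = (Nat.totient t : ℝ) / t := by
  have h := congrArg (Rat.cast : ℚ → ℝ) (Nat.totient_eq_mul_prod_factors t)
  push_cast at h
  rw [h, mul_div_cancel_left₀]
  exact_mod_cast ht

variable [Fintype F]

lemma quadSum_one_one {a b c : F} (ha : a ≠ 0) :
    ∃ m : ℕ, quadSum 1 1 a b c = m ∧ Fintype.card F ≤ m + 3 := by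
  set S : Finset F := {x | x ≠ 0 ∧ a * x ^ 2 + b * x + c ≠ 0} with hS
  set f : F[X] := C a * X ^ 2 + C b * X + C c with hf
  have hfdeg : f.natDegree = 2 := natDegree_quadratic ha
  have hf0 : f ≠ 0 := by
    intro h
    rw [h, natDegree_zero] at hfdeg
    omega
  refine ⟨S.card, ?_, ?_⟩
  · rw [quadSum, Finset.card_eq_sum_ones, Nat.cast_sum, hS, Finset.sum_filter]
    refine Finset.sum_congr rfl fun x _ => ?_
    have h1 (y : F) : (1 : MulChar F ℂ) y = if y ≠ 0 then 1 else 0 := by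
      split_ifs with hy
      · exact MulChar.one_apply (isUnit_iff_ne_zero.mpr hy)
      · rw [not_not.mp hy, MulChar.map_zero]
    rw [h1, h1, ite_and]
    split_ifs <;> simp
  · have hsub : (Finset.univ : Finset F) ⊆ S ∪ ({0} ∪ f.roots.toFinset) := by
      intro x _
      simp only [hS, Finset.mem_union, Finset.mem_filter, Finset.mem_univ, true_and,
        Finset.mem_singleton, Multiset.mem_toFinset, mem_roots hf0, IsRoot.def]
      have : f.eval x = a * x ^ 2 + b * x + c := by simp [hf]
      rw [this]
      tauto
    have h1 := (Finset.card_le_card hsub).trans (Finset.card_union_le _ _)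
    have h2 := Finset.card_union_le {0} f.roots.toFinset
    have h3 := (Multiset.toFinset_card_le f.roots).trans (card_roots' f)
    rw [Finset.card_singleton] at h2
    rw [Finset.card_univ] at h1
    omega

lemma mul_Ncount_eq {t k : ℕ} (ht : t ≠ 0) (hk : k ∣ Fintype.card F - 1) (a b c : F)
    {w : MulChar F ℂ → ℂ} (hw : ∀ x ≠ 0, ∑ χ, w χ * χ x =
      if ∀ ℓ ∈ t.primeFactors, ¬ ∃ z, z ^ ℓ = x then 1 else 0) :
    (k : ℂ) * Ncount F a b c t k = ∑ χ, ∑ ψ ∈ powChars F k, w χ * quadSum χ ψ a b c := by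
  have hq : 0 < Fintype.card F - 1 := Nat.sub_pos_of_lt Fintype.one_lt_card
  have hk0 : k ≠ 0 := by
    rintro rfl
    rw [zero_dvd_iff] at hk
    omega
  have h1 (x : F) : (∑ χ, w χ * χ x) * ∑ ψ ∈ powChars F k, ψ (a * x ^ 2 + b * x + c) =
      if IsTFree t x ∧ ∃ y : F, y ≠ 0 ∧ y ^ k = a * x ^ 2 + b * x + c then (k : ℂ) else 0 := by
    by_cases hx : x = 0
    · subst hx
      rw [if_neg fun h => h.1.1 rfl, Finset.sum_eq_zero, zero_mul]
      intro χ _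
      rw [MulChar.map_zero, mul_zero]
    by_cases hy : a * x ^ 2 + b * x + c = 0
    · rw [hy, if_neg, Finset.sum_eq_zero (s := powChars F k), mul_zero]
      · intro ψ _
        rw [MulChar.map_zero]
      · rintro ⟨-, y, hy, hy'⟩
        exact pow_ne_zero k hy hy'
    · have h2 : (∃ y : F, y ≠ 0 ∧ y ^ k = a * x ^ 2 + b * x + c) ↔
          ∃ y : F, y ^ k = a * x ^ 2 + b * x + c := by
        refine ⟨fun ⟨y, hy⟩ => ⟨y, hy.2⟩, fun ⟨y, hy'⟩ => ⟨y, ?_, hy'⟩⟩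
        rintro rfl
        exact hy (by rw [← hy', zero_pow hk0])
      rw [hw x hx, sum_powChars hk hy]
      simp only [isTFree_iff ht hx, h2, ite_and]
      split_ifs <;> simp
  calc (k : ℂ) * Ncount F a b c t k
      = ∑ x : F, if IsTFree t x ∧ ∃ y : F, y ≠ 0 ∧ y ^ k = a * x ^ 2 + b * x + c
          then (k : ℂ) else 0 := by
        rw [← Finset.sum_filter, Finset.sum_const, nsmul_eq_mul, mul_comm, Ncount,
          Nat.card_eq_card_toFinset]
        congr 3
        ext x
        simp
    _ = ∑ x : F, ∑ χ, ∑ ψ ∈ powChars F k, w χ * (χ x * ψ (a * x ^ 2 + b * x + c)) := by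
        refine Finset.sum_congr rfl fun x _ => ?_
        rw [← h1 x, Finset.sum_mul_sum]
        simp_rw [mul_assoc]
    _ = ∑ χ, ∑ ψ ∈ powChars F k, w χ * quadSum χ ψ a b c := by
        rw [Finset.sum_comm]
        refine Finset.sum_congr rfl fun χ _ => ?_
        rw [Finset.sum_comm]
        refine Finset.sum_congr rfl fun ψ _ => ?_
        rw [quadSum, Finset.mul_sum]

end Counting

end Helpers

theorem Ncount_lower_bound
    {F : Type*} [Field F] [Fintype F] {q k : ℕ} (hq : Fintype.card F = q) (hq5 : 5 ≤ q)
    (hk : 2 ≤ k) (hkdvd : k ∣ q - 1)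
    (a b c : F) (ha : a ≠ 0) (hdisc : b ^ 2 - 4 * a * c ≠ 0)
    {t : ℕ} (ht0 : 0 < t) (htdvd : t ∣ q - 1) :
    (Nat.totient t : ℝ) / ((k : ℝ) * (t : ℝ))
        * ((q : ℝ) - 2 * (k : ℝ) * (Wnum t : ℝ) * Real.sqrt q)
      ≤ (Ncount F a b c t k : ℝ) := by
  subst hq
  have ht : t ≠ 0 := ht0.ne'
  obtain ⟨w, hw1, hw2, hw3, -⟩ := exists_coeff_of_primes (F := F) t.primeFactors fun ℓ hℓ =>
    ⟨Nat.prime_of_mem_primeFactors hℓ, (Nat.dvd_of_mem_primeFactors hℓ).trans htdvd⟩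
  have hN := mul_Ncount_eq ht hkdvd a b c hw1
  obtain ⟨m, hm, hm3⟩ := quadSum_one_one (b := b) (c := c) ha
  have hθ := prod_one_sub_inv ht
  set θ : ℝ := (Nat.totient t : ℝ) / t with hθdef
  have hθ0 : 0 ≤ θ := by positivity
  have hw2' : w 1 = (θ : ℂ) := by
    rw [hw2, ← hθ]
    push_cast
    rfl
  rw [hθ] at hw3
  have hW : ((2 : ℝ) ^ t.primeFactors.card) = (Wnum t : ℝ) := by
    rw [Wnum_eq ht]
    push_cast
    rfl
  rw [hW] at hw3
  set s : ℝ := √(Fintype.card F) with hs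
  have hs0 : 0 ≤ s := Real.sqrt_nonneg _
  set T : Finset (MulChar F ℂ × MulChar F ℂ) := Finset.univ ×ˢ powChars F k with hT
  have h1T : (1, 1) ∈ T := by simp [hT, mem_powChars]
  rw [← Finset.sum_product' (f := fun χ ψ => w χ * quadSum χ ψ a b c),
    ← Finset.add_sum_erase _ _ h1T, hm, hw2'] at hN
  have herr : ‖∑ p ∈ T.erase (1, 1), w p.1 * quadSum p.1 p.2 a b c‖ ≤
      2 * s * (k * (Wnum t * θ) - θ) := by
    have h2 : ∑ p ∈ T, ‖w p.1‖ = k * ∑ χ, ‖w χ‖ := by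
      rw [hT, Finset.sum_product]
      simp [card_powChars hkdvd, Finset.mul_sum]
    have h3 : ∑ p ∈ T.erase (1, 1), ‖w p.1‖ ≤ k * (Wnum t * θ) - θ := by
      rw [← Finset.add_sum_erase _ _ h1T, hw2', Complex.norm_real, Real.norm_of_nonneg hθ0] at h2
      have : (k : ℝ) * ∑ χ, ‖w χ‖ ≤ k * (Wnum t * θ) := by gcongr
      linarith
    calc ‖∑ p ∈ T.erase (1, 1), w p.1 * quadSum p.1 p.2 a b c‖
        ≤ ∑ p ∈ T.erase (1, 1), ‖w p.1‖ * (2 * s) := by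
          refine norm_sum_le_of_le _ fun p hp => ?_
          rw [norm_mul]
          gcongr
          refine norm_quadSum_le ?_ ha hdisc
          by_contra! h
          exact Finset.ne_of_mem_erase hp (Prod.ext h.1 h.2)
      _ = 2 * s * ∑ p ∈ T.erase (1, 1), ‖w p.1‖ := by rw [← Finset.sum_mul, mul_comm]
      _ ≤ _ := by gcongr
  have hkN : θ * m - 2 * s * (k * (Wnum t * θ) - θ) ≤ k * (Ncount F a b c t k : ℝ) := by
    have h4 : ∑ p ∈ T.erase (1, 1), w p.1 * quadSum p.1 p.2 a b c =
        ((k * (Ncount F a b c t k : ℝ) - θ * m : ℝ) : ℂ) := by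
      push_cast
      linear_combination -hN
    rw [h4, Complex.norm_real, Real.norm_eq_abs] at herr
    linarith [(abs_le.mp herr).1]
  have hs3 : 3 ≤ 2 * s := by
    have h5 : (3 / 2 : ℝ) ≤ s := by
      refine Real.le_sqrt_of_sq_le ?_
      have : (5 : ℝ) ≤ Fintype.card F := by exact_mod_cast hq5
      linarith
    linarith
  have hm3' : (Fintype.card F : ℝ) ≤ m + 3 := by exact_mod_cast hm3
  have hk0 : (0 : ℝ) < k := by exact_mod_cast (by omega : 0 < k)
  have h6 : (Nat.totient t : ℝ) / ((k : ℝ) * (t : ℝ)) = θ / k := by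
    rw [hθdef, div_div, mul_comm]
  rw [h6, div_mul_eq_mul_div, div_le_iff₀ hk0]
  have h7 : θ * (Fintype.card F : ℝ) ≤ θ * (m + 2 * s) := by
    gcongr
    linarith
  linarith
end

section
/- Let q ≥ 17 be a prime power. Then ω(q-1) ≤ 1.38402 · log q / log log q, and consequently W(q-1) = 2^{ω(q-1)} ≤ q^{0.96 / log log q}, where log denotes the natural logarithm. -/
/-- The product of `k` distinct primes is at least the product of the first `k` primes. -/
theorem prod_nth_prime_le_prod_of_card_eq (k : ℕ) :
    ∀ S : Finset ℕ, (∀ p ∈ S, p.Prime) → S.card = k →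
      ∏ i ∈ Finset.range k, Nat.nth Nat.Prime i ≤ ∏ p ∈ S, p := by
  induction k with
  | zero =>
    intro S _ hS
    rw [Finset.card_eq_zero] at hS
    simp [hS]
  | succ k ih =>
    intro S hP hS
    obtain ⟨m, hmS, hm⟩ : ∃ m ∈ S, Nat.nth Nat.Prime k ≤ m := by
      by_contra! h
      have hsub : S ⊆ Nat.primesBelow (Nat.nth Nat.Prime k) := fun p hp =>
        Nat.mem_primesBelow.2 ⟨h p hp, hP p hp⟩
      have hcard := Finset.card_le_card hsub
      rw [Nat.primesBelow_card_eq_primeCounting', Nat.primeCounting'_nth_eq] at hcard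
      omega
    rw [Finset.prod_range_succ, ← Finset.prod_erase_mul S _ hmS]
    refine Nat.mul_le_mul (ih _ (fun p hp => hP p (Finset.mem_of_mem_erase hp)) ?_) hm
    rw [Finset.card_erase_of_mem hmS, hS, Nat.add_sub_cancel]

theorem nth_prime_eq_of_count {p k : ℕ} (hp : p.Prime) (hk : Nat.count Nat.Prime p = k) :
    Nat.nth Nat.Prime k = p := by
  rw [← hk, Nat.nth_count hp]

theorem nth_prime_two : Nat.nth Nat.Prime 2 = 5 :=
  nth_prime_eq_of_count (by norm_num) (by decide)

theorem nth_prime_three : Nat.nth Nat.Prime 3 = 7 :=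
  nth_prime_eq_of_count (by norm_num) (by decide)

/-- Primes above `3` are coprime to `6`, so the `k`-th prime (from `0`) is at least `3 k - 2`. -/
theorem three_mul_le_nth_prime_add_two (k : ℕ) :
    3 * (k + 2) ≤ Nat.nth Nat.Prime (k + 2) + 2 := by
  have hmod (j : ℕ) :
      Nat.nth Nat.Prime (j + 2) % 6 = 1 ∨ Nat.nth Nat.Prime (j + 2) % 6 = 5 := by
    have hp := Nat.prime_nth_prime (j + 2)
    have h5 : 5 ≤ Nat.nth Nat.Prime (j + 2) :=
      nth_prime_two ▸ (Nat.nth_monotone Nat.infinite_setOfPred_prime (by omega : 2 ≤ j + 2))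
    have h2 := (Nat.prime_dvd_prime_iff_eq Nat.prime_two hp).not.2 (by omega)
    have h3 := (Nat.prime_dvd_prime_iff_eq Nat.prime_three hp).not.2 (by omega)
    omega
  have hlt (j : ℕ) : Nat.nth Nat.Prime j < Nat.nth Nat.Prime (j + 1) :=
    Nat.nth_strictMono Nat.infinite_setOfPred_prime (Nat.lt_succ_self j)
  induction k using Nat.twoStepInduction with
  | zero => rw [nth_prime_two]; norm_num
  | one => rw [nth_prime_three]
  | more k ih _ =>
    have h0 := hmod k
    have h1 := hmod (k + 1)
    have h2 := hmod (k + 2)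
    have h3 := hlt (k + 2)
    have h4 := hlt (k + 3)
    simp only [add_assoc, Nat.reduceAdd] at *
    omega

theorem prod_range_nth_prime_eq_prod_getD :
    ∀ k ∈ Finset.Icc 4 12, ∏ i ∈ Finset.range k, Nat.nth Nat.Prime i =
      ∏ i ∈ Finset.range k, [2, 3, 5, 7, 11, 13, 17, 19, 23, 29, 31, 37].getD i 0 := by
  intro k hk
  refine Finset.prod_congr rfl fun i hi => ?_
  have hi12 : i < 12 := by simp only [Finset.mem_Icc, Finset.mem_range] at hk hi; omega
  interval_cases i <;> exact nth_prime_eq_of_count (by norm_num) (by decide)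

/-- A bound `k log L ≤ 1.38402 L` follows from the tangent line of `log` at any `A`. -/
theorem mul_log_le_of_tangent {k A a l L : ℝ} (hk : 0 ≤ k) (hA : 0 < A) (ha : Real.log A ≤ a)
    (hl : 0 < l) (hL : l ≤ L) (hkA : k / A ≤ 1.38402) (h : k * (a - 1) ≤ l * (1.38402 - k / A)) :
    k * Real.log L ≤ 1.38402 * L := by
  have hL0 : 0 < L := hl.trans_le hL
  have h1 := Real.log_le_sub_one_of_pos (div_pos hL0 hA)
  rw [Real.log_div hL0.ne' hA.ne'] at h1
  have h2 : k * Real.log L ≤ k * (a - 1 + L / A) :=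
    mul_le_mul_of_nonneg_left (by linarith) hk
  have h3 : l * (1.38402 - k / A) ≤ L * (1.38402 - k / A) :=
    mul_le_mul_of_nonneg_right hL (by linarith)
  have h4 : k * (L / A) = L * (k / A) := by ring
  linarith

/-- The logarithm of `2 ^ x * 3 ^ y * 5 ^ z`. -/
theorem log_smooth (x y z : ℕ) : Real.log ((2 : ℝ) ^ x * 3 ^ y * 5 ^ z) =
    x * Real.log 2 + y * Real.log 3 + z * Real.log 5 := by
  rw [Real.log_mul (by positivity) (by positivity), Real.log_mul (by positivity) (by positivity),
    Real.log_pow, Real.log_pow, Real.log_pow]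

theorem log_smooth_le (x y z : ℕ) {P : ℝ} (h : (2 : ℝ) ^ x * 3 ^ y * 5 ^ z ≤ P) :
    x * Real.log 2 + y * Real.log 3 + z * Real.log 5 ≤ Real.log P := by
  rw [← log_smooth]
  exact Real.log_le_log (by positivity) h

/-- For `k ≥ 12`, the product of the first `k` primes is at least `(2.6041 k / e) ^ k`. -/
theorem mul_log_sub_le_log_prod_nth_prime (k : ℕ) (hk : 12 ≤ k) :
    (k : ℝ) * (Real.log (2.6041 * k) - 1) ≤
      Real.log ((∏ i ∈ Finset.range k, Nat.nth Nat.Prime i : ℕ) : ℝ) := by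
  induction k, hk using Nat.le_induction with
  | base =>
    rw [prod_range_nth_prime_eq_prod_getD 12 (by decide)]
    have h1 : Real.log (2.6041 * (12 : ℕ)) ≤ 3 * Real.log 5 - 2 * Real.log 2 := by
      have h : Real.log (5 ^ 3 / 2 ^ 2) = 3 * Real.log 5 - 2 * Real.log 2 := by
        rw [Real.log_div (by norm_num) (by norm_num), Real.log_pow, Real.log_pow]
        norm_num
      rw [← h]
      exact Real.log_le_log (by norm_num) (by norm_num)
    have h2 := log_smooth_le 14 2 11 (P := ((∏ i ∈ Finset.range 12,
      [2, 3, 5, 7, 11, 13, 17, 19, 23, 29, 31, 37].getD i 0 : ℕ) : ℝ))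
      (by norm_num [Finset.prod_range_succ])
    have := Real.log_two_gt_d9
    have := Real.log_three_gt_d9
    have := Real.log_five_gt_d9
    have := Real.log_five_lt_d9
    push_cast at h1 h2 ⊢
    linarith
  | succ k hk ih =>
    have hk0 : (12 : ℝ) ≤ k := by exact_mod_cast hk
    have hp : (2.6041 * (k + 1) : ℝ) ≤ Nat.nth Nat.Prime k := by
      obtain ⟨j, rfl⟩ : ∃ j, k = j + 2 := ⟨k - 2, by omega⟩
      have h := three_mul_le_nth_prime_add_two j
      have h' : (3 * ((j + 2 : ℕ) : ℝ)) ≤ Nat.nth Nat.Prime (j + 2) + 2 := by exact_mod_cast h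
      linarith
    have hprod : ((∏ i ∈ Finset.range k, Nat.nth Nat.Prime i : ℕ) : ℝ) ≠ 0 := by
      exact_mod_cast Finset.prod_ne_zero_iff.2 fun i _ => (Nat.prime_nth_prime i).ne_zero
    have hpl := Real.log_le_log (by positivity) hp
    rw [Finset.prod_range_succ, Nat.cast_mul, Real.log_mul hprod
      (by exact_mod_cast (Nat.prime_nth_prime k).ne_zero)]
    have hkk := Real.log_le_sub_one_of_pos (show (0 : ℝ) < (k + 1) / k by positivity)
    rw [Real.log_div (by positivity) (by positivity)] at hkk
    have hk1 : (k : ℝ) * (Real.log (k + 1) - Real.log k) ≤ 1 := by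
      calc _ ≤ (k : ℝ) * (((k : ℝ) + 1) / k - 1) := by gcongr
        _ = 1 := by field_simp; ring
    rw [Real.log_mul (by norm_num) (by positivity)] at ih hpl
    push_cast at ih ⊢
    rw [Real.log_mul (by norm_num) (by positivity)]
    linarith

theorem log_primorial_twentyThree_gt : 19.22309 < Real.log 223092870 := by
  have h := Real.one_sub_inv_le_log_of_pos
    (show (0 : ℝ) < 223092870 * 5 ^ 4 / (2 ^ 18 * 3 ^ 12) by norm_num)
  rw [Real.log_div (by norm_num) (by norm_num), Real.log_mul (by norm_num) (by norm_num),
    Real.log_mul (by norm_num) (by norm_num), Real.log_pow, Real.log_pow, Real.log_pow] at h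
  norm_num at h
  linarith [Real.log_two_gt_d9, Real.log_three_gt_d9, Real.log_five_lt_d9]

theorem log_approx_log_primorial_twentyThree_lt : Real.log 19.2231 < 2.956114 := by
  have h := Real.log_le_sub_one_of_pos
    (show (0 : ℝ) < 19.2231 * 5 / (2 ^ 5 * 3) by norm_num)
  rw [Real.log_div (by norm_num) (by norm_num), Real.log_mul (by norm_num) (by norm_num),
    Real.log_mul (by norm_num) (by norm_num), Real.log_pow] at h
  push_cast at h
  linarith [Real.log_two_lt_d9, Real.log_three_lt_d9, Real.log_five_gt_d9]

theorem mul_log_le_of_prod_nth_prime_le {k : ℕ} (hk : 4 ≤ k) {L : ℝ}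
    (hL : Real.log ((∏ i ∈ Finset.range k, Nat.nth Nat.Prime i : ℕ) : ℝ) ≤ L) :
    k * Real.log L ≤ 1.38402 * L := by
  have b1 := Real.log_two_gt_d9
  have b2 := Real.log_two_lt_d9
  have b3 := Real.log_three_gt_d9
  have b4 := Real.log_three_lt_d9
  have b5 := Real.log_five_gt_d9
  have b6 := Real.log_five_lt_d9
  rcases le_or_gt 12 k with hk12 | hk12
  · have hk0 : (12 : ℝ) ≤ k := by exact_mod_cast hk12
    have h1 := (mul_log_sub_le_log_prod_nth_prime k hk12).trans hL
    have h2 : 1 < Real.log (2.6041 * k) := by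
      rw [Real.lt_log_iff_exp_lt (by positivity)]
      linarith [Real.exp_one_lt_three]
    refine mul_log_le_of_tangent (A := 2.6041 * k) (by positivity) (by positivity) le_rfl
      (mul_pos (by positivity) (by linarith)) h1 ?_ ?_
    · rw [div_le_iff₀ (by positivity)]; linarith
    · have h3 : (k : ℝ) / (2.6041 * k) ≤ 0.38402 := by
        rw [div_le_iff₀ (by positivity)]; linarith
      exact le_mul_of_one_le_right (mul_nonneg (by positivity) (by linarith)) (by linarith)
  · rw [prod_range_nth_prime_eq_prod_getD k (Finset.mem_Icc.2 ⟨hk, hk12.le⟩)] at hL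
    have key (x y z : ℕ) (A a l : ℝ) (hA : 0 < A) (ha : Real.log A ≤ a) (hl0 : 0 < l)
        (hl : l ≤ x * Real.log 2 + y * Real.log 3 + z * Real.log 5)
        (hP : (2 : ℝ) ^ x * 3 ^ y * 5 ^ z ≤ ((∏ i ∈ Finset.range k,
          [2, 3, 5, 7, 11, 13, 17, 19, 23, 29, 31, 37].getD i 0 : ℕ) : ℝ))
        (hkA : (k : ℝ) / A ≤ 1.38402) (h : k * (a - 1) ≤ l * (1.38402 - k / A)) :
        k * Real.log L ≤ 1.38402 * L :=
      mul_log_le_of_tangent (by positivity) hA ha hl0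
        ((hl.trans (log_smooth_le x y z hP)).trans hL) hkA h
    have l8 := log_smooth 3 0 0
    have l10 := log_smooth 1 0 1
    have l12 := log_smooth 2 1 0
    have l16 := log_smooth 4 0 0
    have l24 := log_smooth 3 1 0
    have l27 := log_smooth 0 3 0
    norm_num at l8 l10 l12 l16 l24 l27
    interval_cases k
    · exact key 3 0 2 5 1.6095 5.298 (by norm_num) (by linarith) (by norm_num)
        (by push_cast; linarith) (by norm_num [Finset.prod_range_succ]) (by norm_num) (by norm_num)
    · exact key 8 2 0 8 2.0795 7.742 (by norm_num) (by linarith) (by norm_num)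
        (by push_cast; linarith) (by norm_num [Finset.prod_range_succ]) (by norm_num) (by norm_num)
    · exact key 4 1 4 10 2.3026 10.308 (by norm_num) (by linarith) (by norm_num)
        (by push_cast; linarith) (by norm_num [Finset.prod_range_succ]) (by norm_num) (by norm_num)
    · exact key 1 4 5 12 2.485 13.13 (by norm_num) (by linarith) (by norm_num)
        (by push_cast; linarith) (by norm_num [Finset.prod_range_succ]) (by norm_num) (by norm_num)
    · exact key 10 1 5 16 2.7726 16.077 (by norm_num) (by linarith) (by norm_num)
        (by push_cast; linarith) (by norm_num [Finset.prod_range_succ]) (by norm_num) (by norm_num)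
    · refine mul_log_le_of_tangent (by norm_num) (by norm_num)
        log_approx_log_primorial_twentyThree_lt.le (by norm_num)
        (log_primorial_twentyThree_gt.le.trans ?_) (by norm_num) (by norm_num)
      norm_num [Finset.prod_range_succ] at hL
      exact hL
    · exact key 14 0 8 24 3.1781 22.579 (by norm_num) (by linarith) (by norm_num)
        (by push_cast; linarith) (by norm_num [Finset.prod_range_succ]) (by norm_num) (by norm_num)
    · exact key 12 0 11 27 3.2959 26.0215 (by norm_num) (by linarith) (by norm_num)
        (by push_cast; linarith) (by norm_num [Finset.prod_range_succ]) (by norm_num) (by norm_num)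

theorem card_primeFactors_mul_log_le {n : ℕ} (hn : n ≠ 0) {L : ℝ} (hL : Real.log n ≤ L)
    (hL0 : 1 ≤ L) :
    (n.primeFactors.card : ℝ) * Real.log L ≤ 1.38402 * L := by
  rcases le_or_gt 4 n.primeFactors.card with h4 | h4
  · refine mul_log_le_of_prod_nth_prime_le h4 (le_trans ?_ hL)
    refine Real.log_le_log ?_ ?_
    · exact_mod_cast Finset.prod_pos fun i _ => (Nat.prime_nth_prime i).pos
    · exact_mod_cast (prod_nth_prime_le_prod_of_card_eq _ n.primeFactors
        (fun p hp => Nat.prime_of_mem_primeFactors hp) rfl).trans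
          (Nat.le_of_dvd (Nat.pos_of_ne_zero hn) (Nat.prod_primeFactors_dvd n))
  · have h3 : (n.primeFactors.card : ℝ) ≤ 3 := by exact_mod_cast Nat.le_of_lt_succ h4
    have he := Real.exp_one_gt_d9
    have h1 : Real.log L ≤ L / Real.exp 1 := by
      have h := Real.log_le_sub_one_of_pos (show 0 < L / Real.exp 1 by positivity)
      rw [Real.log_div (by positivity) (by positivity), Real.log_exp] at h
      linarith
    have h2 : L / Real.exp 1 ≤ L / 2.71 := by gcongr; linarith
    calc (n.primeFactors.card : ℝ) * Real.log L ≤ 3 * (L / 2.71) :=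
          mul_le_mul h3 (h1.trans h2) (Real.log_nonneg hL0) (by norm_num)
      _ ≤ 1.38402 * L := by
        rw [← mul_div_assoc, div_le_iff₀ (by norm_num)]
        linarith

theorem Wnum_eq_two_pow_card_primeFactors {n : ℕ} (hn : n ≠ 0) :
    Wnum n = 2 ^ n.primeFactors.card := by
  have h := Nat.sum_divisors_filter_squarefree hn (f := fun _ => 1)
  simp only [Finset.sum_const, smul_eq_mul, mul_one, Finset.card_powerset] at h
  rw [Wnum, h, Nat.factors_eq]
  rfl

theorem omega_and_W_bound {q : ℕ} (hq : ∃ p n : ℕ, p.Prime ∧ 0 < n ∧ q = p ^ n)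
    (hq17 : 17 ≤ q) :
    ((q - 1).primeFactors.card : ℝ) ≤ 1.38402 * Real.log q / Real.log (Real.log q) ∧
    Wnum (q - 1) = 2 ^ (q - 1).primeFactors.card ∧
    (Wnum (q - 1) : ℝ) ≤ (q : ℝ) ^ ((0.96 : ℝ) / Real.log (Real.log q)) := by
  have hn : q - 1 ≠ 0 := by omega
  have hqR : (17 : ℝ) ≤ q := by exact_mod_cast hq17
  have hq0 : (0 : ℝ) < q := by linarith
  have hL1 : 1 < Real.log q := by
    rw [Real.lt_log_iff_exp_lt hq0]
    linarith [Real.exp_one_lt_three]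
  have hLL : 0 < Real.log (Real.log q) := Real.log_pos hL1
  have hlog : Real.log ((q - 1 : ℕ) : ℝ) ≤ Real.log q :=
    Real.log_le_log (by exact_mod_cast Nat.pos_of_ne_zero hn) (by exact_mod_cast Nat.sub_le q 1)
  have hω : ((q - 1).primeFactors.card : ℝ) ≤ 1.38402 * Real.log q / Real.log (Real.log q) :=
    (le_div_iff₀ hLL).2 (card_primeFactors_mul_log_le hn hlog hL1.le)
  have hW := Wnum_eq_two_pow_card_primeFactors hn
  refine ⟨hω, hW, ?_⟩
  rw [hW, Nat.cast_pow, Nat.cast_ofNat, ← Real.rpow_natCast,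
    Real.rpow_def_of_pos two_pos, Real.rpow_def_of_pos hq0, Real.exp_le_exp]
  have h2 := Real.log_two_lt_d9
  calc Real.log 2 * ((q - 1).primeFactors.card : ℝ)
      ≤ 0.6931471808 * (1.38402 * Real.log q / Real.log (Real.log q)) := by gcongr
    _ = (0.6931471808 * 1.38402) * (Real.log q / Real.log (Real.log q)) := by ring
    _ ≤ 0.96 * (Real.log q / Real.log (Real.log q)) := by gcongr; norm_num
    _ = Real.log q * (0.96 / Real.log (Real.log q)) := by ring
end
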